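/- There exists an absolute constant C > 0 such that for every odd prime p and every integer J with p^{1/2} log p ≤ J ≤ (p−1)/2, one has |∑_{j=1}^{J} (−1)^j d_j| ≤ C · J^{3/4} · p^{1/8} · (log p)^{1/4}, where d_j = n_j − n_{j−1} are the spacings between consecutive quadratic nonresidues modulo p. -/

import Mathlib

section

open Polynomial

/-- In a field, if `ρ ^ 2 = c f σ ^ 2` with `c ≠ 0` and `f` squarefree and nonconstant,
then `ρ = σ = 0`. -/
lemma eq_zero_of_sq_eq_squarefree_mul_sq {F : Type*} [Field F] {f ρ σ : F[X]}
    (hf : Squarefree f) (hd : 0 < f.natDegree) {c : F} (hc : c ≠ 0)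
    (h : ρ ^ 2 = C c * f * σ ^ 2) : ρ = 0 ∧ σ = 0 := by
  have hf0 : f ≠ 0 := hf.ne_zero
  by_cases hs : σ = 0
  · subst hs
    simpa using h
  exfalso
  have hdvd : σ ∣ ρ := by
    have : σ ^ 2 ∣ ρ ^ 2 := ⟨C c * f, by rw [h]; ring⟩
    exact (UniqueFactorizationMonoid.pow_dvd_pow_iff_dvd two_ne_zero).1 this
  obtain ⟨τ, rfl⟩ := hdvd
  have h2 : τ ^ 2 = C c * f := by
    have : σ ^ 2 * (τ ^ 2) = σ ^ 2 * (C c * f) := by rw [← mul_pow, h]; ring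
    exact mul_left_cancel₀ (pow_ne_zero 2 hs) this
  have hu : IsUnit τ := by
    apply hf
    refine ⟨C c⁻¹, ?_⟩
    rw [← sq, h2, mul_comm (C c) f, mul_assoc, ← C_mul, mul_inv_cancel₀ hc]
    simp
  have h3 : f.natDegree = 0 := by
    have h4 := natDegree_eq_zero_of_isUnit (hu.pow 2)
    rwa [h2, natDegree_C_mul hc] at h4
  omega

lemma mem_degreeLT_of_natDegree_lt {F : Type*} [Field F] {P : F[X]} {n : ℕ}
    (h : P.natDegree < n) : P ∈ degreeLT F n :=
  mem_degreeLT.2 (degree_le_natDegree.trans_lt (by exact_mod_cast h))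

lemma natDegree_lt_of_mem_degreeLT {F : Type*} [Field F] {P : F[X]} {n : ℕ}
    (h : P ∈ degreeLT F n) (hn : 0 < n) : P.natDegree < n := by
  rcases eq_or_ne P 0 with rfl | hP
  · simpa using hn
  · exact (natDegree_lt_iff_degree_lt hP).2 (mem_degreeLT.1 h)

/-- Low-order vanishing forces vanishing, for combinations of `1` and a half-integral power of a
squarefree polynomial. -/
lemma eq_zero_of_X_pow_dvd_add_mul_pow {F : Type*} [Field F] (p : ℕ) [Fact p.Prime] [CharP F p]
    {s e R : ℕ} (he : 2 * e = p ^ s + 1) {f ρ σ : F[X]} (hf : Squarefree f)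
    (hd : 0 < f.natDegree) (hf0 : f.coeff 0 ≠ 0) (hR : 2 * R + f.natDegree ≤ p ^ s + 1)
    (hρ : ρ ∈ degreeLT F R) (hσ : σ ∈ degreeLT F R) (h : X ^ p ^ s ∣ ρ + σ * f ^ e) :
    ρ = 0 ∧ σ = 0 := by
  rcases Nat.eq_zero_or_pos R with rfl | hRpos
  · simp only [mem_degreeLT, Nat.cast_zero] at hρ hσ
    exact ⟨by simpa using hρ, by simpa using hσ⟩
  have hρ' := natDegree_lt_of_mem_degreeLT hρ hRpos
  have hσ' := natDegree_lt_of_mem_degreeLT hσ hRpos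
  set c := f.coeff 0 ^ p ^ s with hcdef
  have hc : c ≠ 0 := pow_ne_zero _ hf0
  have h1 : X ^ p ^ s ∣ f ^ p ^ s - C c := by
    rw [hcdef, C_pow, ← sub_pow_char_pow]
    apply pow_dvd_pow_of_dvd
    rw [X_dvd_iff]; simp
  have h2 : X ^ p ^ s ∣ ρ ^ 2 - C c * f * σ ^ 2 := by
    have : ρ ^ 2 - C c * f * σ ^ 2
        = (ρ + σ * f ^ e) * (ρ - σ * f ^ e) + (f ^ p ^ s - C c) * (f * σ ^ 2) := by
      have h3 : f ^ e * f ^ e = f ^ p ^ s * f := by rw [← pow_add, ← two_mul, he, pow_succ]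
      linear_combination (σ ^ 2) * h3
    rw [this]
    exact dvd_add (h.mul_right _) (h1.mul_right _)
  have h3 : ρ ^ 2 - C c * f * σ ^ 2 = 0 := by
    apply eq_zero_of_dvd_of_natDegree_lt h2
    rw [natDegree_X_pow]
    have a1 : (ρ ^ 2).natDegree ≤ 2 * (R - 1) := natDegree_pow_le.trans (by gcongr; omega)
    have a2 : (C c * f * σ ^ 2).natDegree ≤ f.natDegree + 2 * (R - 1) := by
      refine natDegree_mul_le.trans ?_
      gcongr
      · exact natDegree_C_mul_le _ _
      · exact natDegree_pow_le.trans (by gcongr; omega)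
    have := natDegree_sub_le (ρ ^ 2) (C c * f * σ ^ 2)
    omega
  exact eq_zero_of_sq_eq_squarefree_mul_sq hf hd hc (sub_eq_zero.1 h3)

/-- The Stepanov auxiliary polynomial is nonzero. -/
lemma eq_zero_of_sum_mul_X_pow_eq_zero {F : Type*} [Field F] (p : ℕ) [Fact p.Prime] [CharP F p]
    {s e R : ℕ} (he : 2 * e = p ^ s + 1) {f : F[X]} (hf : Squarefree f)
    (hd : 0 < f.natDegree) (hf0 : f.coeff 0 ≠ 0) (hR : 2 * R + f.natDegree ≤ p ^ s + 1)
    (J : ℕ) (ρ σ : Fin J → F[X])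
    (hρ : ∀ j, ρ j ∈ degreeLT F R) (hσ : ∀ j, σ j ∈ degreeLT F R)
    (h : ∑ j, (ρ j + σ j * f ^ e) * X ^ (p ^ s * (j : ℕ)) = 0) (j : Fin J) :
    ρ j = 0 ∧ σ j = 0 := by
  induction J with
  | zero => exact j.elim0
  | succ J ih =>
    rw [Fin.sum_univ_succ] at h
    have hfac : ∑ i : Fin J, (ρ i.succ + σ i.succ * f ^ e) * X ^ (p ^ s * (i.succ : ℕ))
        = X ^ p ^ s * ∑ i : Fin J, (ρ i.succ + σ i.succ * f ^ e) * X ^ (p ^ s * (i : ℕ)) := by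
      rw [Finset.mul_sum]
      refine Finset.sum_congr rfl fun i _ => ?_
      rw [Fin.val_succ, mul_add, mul_one, pow_add]
      ring
    rw [hfac] at h
    simp only [Fin.val_zero, mul_zero, pow_zero, mul_one] at h
    have h0 : ρ 0 = 0 ∧ σ 0 = 0 := by
      refine eq_zero_of_X_pow_dvd_add_mul_pow p he hf hd hf0 hR (hρ 0) (hσ 0) ?_
      rw [eq_neg_of_add_eq_zero_left h]
      exact (Dvd.intro _ rfl).neg_right
    rw [h0.1, h0.2, zero_mul, zero_add, zero_add] at h
    have h' := (mul_eq_zero.1 h).resolve_left (pow_ne_zero _ X_ne_zero)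
    refine Fin.cases h0 (fun i => ?_) j
    exact ih _ _ (fun i => hρ _) (fun i => hσ _) h' i


/-- Stepanov's bound for the number of points at which a squarefree polynomial takes values in a
given class modulo squares. -/
lemma card_filter_pow_eq_le {F : Type*} [Field F] [Fintype F] [DecidableEq F] (p : ℕ)
    [Fact p.Prime] [CharP F p] {s e R J m : ℕ} (he : 2 * e = p ^ s + 1)
    (hm : 2 * m + 1 = p ^ (2 * s))
    (hF : Fintype.card F = p ^ (2 * s)) {f : F[X]} (hf : Squarefree f)
    (hd : 0 < f.natDegree) (hf0 : f.coeff 0 ≠ 0) (hR : 2 * R + f.natDegree ≤ p ^ s + 1)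
    (hR0 : 0 < R) (hRJ : p ^ s * R + f.natDegree * e + J < 2 * R * J) (ε : F) :
    (Finset.univ.filter fun x : F => f.eval x ^ m = ε).card
      ≤ R + f.natDegree * e + p ^ s * J := by
  classical
  have hp := (Fact.out : p.Prime)
  have hl : 0 < p ^ s := pow_pos hp.pos s
  set E := p ^ s * R + f.natDegree * e + J with hE
  have memaux (v : degreeLT F R) : (v : F[X]).natDegree < R :=
    natDegree_lt_of_mem_degreeLT v.2 hR0
  let Q : (Fin J → degreeLT F R × degreeLT F R) → F[X] := fun v =>
    ∑ j, (((v j).1 : F[X]) ^ p ^ s + C ε * ((v j).2 : F[X]) ^ p ^ s * f ^ e) * X ^ (j : ℕ)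
  have hQdeg (v) : Q v ∈ degreeLT F E := by
    refine Submodule.sum_mem _ fun j _ => mem_degreeLT_of_natDegree_lt ?_
    have b1 : (((v j).1 : F[X]) ^ p ^ s).natDegree ≤ p ^ s * R :=
      natDegree_pow_le.trans (by gcongr; exact (memaux _).le)
    have b2 : (((v j).2 : F[X]) ^ p ^ s).natDegree ≤ p ^ s * R :=
      natDegree_pow_le.trans (by gcongr; exact (memaux _).le)
    have b3 : (f ^ e).natDegree ≤ f.natDegree * e := natDegree_pow_le.trans (by rw [mul_comm])
    have b4 : (C ε * ((v j).2 : F[X]) ^ p ^ s * f ^ e).natDegree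
        ≤ p ^ s * R + f.natDegree * e :=
      natDegree_mul_le.trans (add_le_add ((natDegree_C_mul_le _ _).trans b2) b3)
    have b5 := natDegree_add_le (((v j).1 : F[X]) ^ p ^ s)
      (C ε * ((v j).2 : F[X]) ^ p ^ s * f ^ e)
    have b6 := natDegree_mul_le (p := (((v j).1 : F[X]) ^ p ^ s + C ε * ((v j).2 : F[X]) ^ p ^ s
      * f ^ e)) (q := X ^ (j : ℕ))
    rw [natDegree_X_pow] at b6
    have := j.2
    have b7 : max (((v j).1 : F[X]) ^ p ^ s).natDegree
      (C ε * ((v j).2 : F[X]) ^ p ^ s * f ^ e).natDegree ≤ p ^ s * R + f.natDegree * e :=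
      max_le (b1.trans (Nat.le_add_right _ _)) b4
    omega
  have : ∀ n, Fintype (degreeLT F n) := fun n => Fintype.ofEquiv _ (degreeLTEquiv F n).symm.toEquiv
  have hcard (n : ℕ) : Fintype.card (degreeLT F n) = Fintype.card F ^ n := by
    rw [Fintype.card_congr (degreeLTEquiv F n).toEquiv]; simp
  have hpig : Fintype.card (degreeLT F E) < Fintype.card (Fin J → degreeLT F R × degreeLT F R) := by
    rw [Fintype.card_fun, Fintype.card_prod, hcard, hcard, Fintype.card_fin, ← pow_add, ← pow_mul]
    apply Nat.pow_lt_pow_right Fintype.one_lt_card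
    rw [← two_mul]; exact hRJ
  obtain ⟨v, w, hvw, hQ⟩ := Fintype.exists_ne_map_eq_of_card_lt
    (fun v => (⟨Q v, hQdeg v⟩ : degreeLT F E)) hpig
  have hQ' : Q v = Q w := congrArg Subtype.val hQ
  have hQsub : Q (v - w) = 0 := by
    have : Q (v - w) = Q v - Q w := by
      simp only [Q, ← Finset.sum_sub_distrib]
      refine Finset.sum_congr rfl fun j _ => ?_
      simp only [Pi.sub_apply, Prod.fst_sub, Prod.snd_sub, Submodule.coe_sub, sub_pow_char_pow]
      ring
    rw [this, hQ', sub_self]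
  set u := v - w with hu
  have hu0 : u ≠ 0 := sub_ne_zero.2 hvw
  set H : F[X] := ∑ j : Fin J, (((u j).1 : F[X]) + ((u j).2 : F[X]) * f ^ e) * X ^ (p ^ s * (j : ℕ))
    with hH
  have hH0 : H ≠ 0 := by
    intro h0
    apply hu0
    funext j
    have := eq_zero_of_sum_mul_X_pow_eq_zero p he hf hd hf0 hR J (fun j => ((u j).1 : F[X]))
      (fun j => ((u j).2 : F[X])) (fun j => (u j).1.2) (fun j => (u j).2.2) h0 j
    exact Prod.ext (Subtype.ext this.1) (Subtype.ext this.2)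
  have hroot : (Finset.univ.filter fun x : F => f.eval x ^ m = ε) ⊆ H.roots.toFinset := by
    intro x hx
    rw [Finset.mem_filter] at hx
    rw [Multiset.mem_toFinset, mem_roots hH0, IsRoot.def]
    have hxq : x ^ (p ^ s * p ^ s) = x := by
      rw [← pow_add, ← two_mul, ← hF, FiniteField.pow_card]
    refine eq_zero_of_pow_eq_zero (n := p ^ s) ?_
    have hem : e * p ^ s = m + e := by
      have : p ^ (2 * s) = p ^ s * p ^ s := by rw [two_mul, pow_add]
      rw [this] at hm
      nlinarith
    rw [hH, eval_finsetSum, sum_pow_char_pow]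
    have := congrArg (eval x) hQsub
    simp only [Q, eval_finsetSum, eval_zero] at this
    rw [← this]
    refine Finset.sum_congr rfl fun j _ => ?_
    simp only [eval_mul, eval_add, eval_pow, eval_X, eval_C, mul_pow, add_pow_char_pow]
    rw [← pow_mul, hem, pow_add, hx.2, ← pow_mul, mul_right_comm, pow_mul x, hxq]
    ring
  calc _ ≤ H.roots.toFinset.card := Finset.card_le_card hroot
    _ ≤ H.natDegree := (Multiset.toFinset_card_le _).trans (card_roots' _)
    _ ≤ _ := by
      refine natDegree_sum_le_of_forall_le _ _ fun j _ => ?_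
      have b3 : (f ^ e).natDegree ≤ f.natDegree * e := natDegree_pow_le.trans (by rw [mul_comm])
      have b4 : (((u j).2 : F[X]) * f ^ e).natDegree ≤ R + f.natDegree * e :=
        natDegree_mul_le.trans (add_le_add (memaux _).le b3)
      have b5 := natDegree_add_le ((u j).1 : F[X]) (((u j).2 : F[X]) * f ^ e)
      refine natDegree_mul_le.trans ?_
      rw [natDegree_X_pow]
      refine add_le_add (b5.trans (max_le ((memaux _).le.trans (Nat.le_add_right _ _)) b4)) ?_
      exact Nat.mul_le_mul_left _ j.2.le

end

section

open Polynomial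

lemma separable_comp_of_isUnit_derivative {F : Type*} [Field F] {f u : F[X]} (hf : f.Separable)
    (hu : IsUnit (derivative u)) : (f.comp u).Separable := by
  obtain ⟨a, b, hab⟩ := hf
  obtain ⟨v, hv⟩ := hu.exists_right_inv
  refine ⟨a.comp u, b.comp u * v, ?_⟩
  rw [derivative_comp]
  have := congrArg (fun g => g.comp u) hab
  simp only [add_comp, mul_comp, one_comp] at this
  linear_combination this + (b.comp u * (derivative f).comp u) * hv

lemma abs_sum_quadraticChar_le_of_eval_zero_ne {F : Type*} [Field F] [Fintype F] [DecidableEq F]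
    (p : ℕ) [Fact p.Prime] [CharP F p] (hp2 : p ≠ 2) {s : ℕ}
    (hF : Fintype.card F = p ^ (2 * s)) {f : F[X]} (hf : f.Separable)
    (hd : 0 < f.natDegree) (hf0 : f.coeff 0 ≠ 0) (hs : 2 * f.natDegree + 2 ≤ p ^ s) :
    |∑ x, quadraticChar F (f.eval x)| ≤ (5 * f.natDegree + 6) * p ^ s := by
  have hp := (Fact.out : p.Prime)
  have hodd : Odd p := hp.odd_of_ne_two hp2
  have hring : ringChar F ≠ 2 := by rwa [ringChar.eq F p]
  have hne : (-1 : F) ≠ 1 := Ring.neg_one_ne_one_of_char_ne_two hring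
  obtain ⟨t, ht⟩ := hodd.pow (n := s)
  obtain ⟨m, hm⟩ := hodd.pow (n := 2 * s)
  have hmF : Fintype.card F / 2 = m := by omega
  have hl2 : p ^ (2 * s) = p ^ s * p ^ s := by rw [two_mul, pow_add]
  set D := f.natDegree with hD
  set l := p ^ s with hl
  obtain ⟨R, hR1, hR2⟩ : ∃ R, 2 * R + D ≤ l + 1 ∧ l ≤ 2 * R + D := ⟨(l + 1 - D) / 2, by omega, by omega⟩
  have key (ε : F) : (2 * (Finset.univ.filter fun x : F => f.eval x ^ m = ε).card : ℤ)
      ≤ l * l + (4 * D + 6) * l := by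
    have h := card_filter_pow_eq_le (e := t + 1) (m := m) (J := t + D + 2) (R := R) p (s := s)
      (by omega) (by omega) hF hf.squarefree hd hf0 (by omega) (by omega)
      (by
        rw [← hl, ← hD, ht]
        have h1 : 2 * t + 1 ≤ 2 * R + D := by omega
        have h2 : 2 * D + 1 ≤ 2 * t := by omega
        have h3 : 2 * D + 1 ≤ 2 * R + D := by omega
        nlinarith [Nat.mul_le_mul h1 (le_refl (2 * D + 3))]) ε
    rw [← hl, ← hD] at h
    have h' : ((Finset.univ.filter fun x : F => f.eval x ^ m = ε).card : ℤ)
      ≤ R + D * (t + 1) + l * (t + D + 2) := by exact_mod_cast h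
    have ht' : (l : ℤ) = 2 * t + 1 := by exact_mod_cast ht
    have hR1' : (2 * R + D : ℤ) ≤ l + 1 := by exact_mod_cast hR1
    have hs' : (2 * D + 2 : ℤ) ≤ l := by exact_mod_cast hs
    have hD' : (0 : ℤ) < D := by exact_mod_cast hd
    have e1 : (2 * t : ℤ) = l - 1 := by omega
    have e2 : (l : ℤ) * (2 * t) = l * (l - 1) := by rw [e1]
    have e3 : (D : ℤ) * (2 * t) = D * (l - 1) := by rw [e1]
    nlinarith
  have hpt (x : F) : quadraticChar F (f.eval x) =
      2 * (if f.eval x ^ m = 1 then 1 else 0) - 1 + (if f.eval x = 0 then 1 else 0) ∧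
      quadraticChar F (f.eval x) =
      1 - 2 * (if f.eval x ^ m = -1 then 1 else 0) - (if f.eval x = 0 then 1 else 0) := by
    have hm0 : m ≠ 0 := by
      rintro rfl
      have := Fintype.one_lt_card (α := F)
      omega
    have hq := quadraticChar_eq_pow_of_char_ne_two' hring (f.eval x)
    rw [hmF] at hq
    by_cases hx : f.eval x = 0
    · simp [hx, hm0]
    · rcases quadraticChar_dichotomy hx with h | h
      · rw [h] at hq ⊢
        rw [← hq]
        simp [hx, hne.symm]
      · rw [h] at hq ⊢
        rw [← hq]
        simp [hx, hne]
  have hzero : ((Finset.univ.filter fun x : F => f.eval x = 0).card : ℤ) ≤ D := by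
    have : (Finset.univ.filter fun x : F => f.eval x = 0) ⊆ f.roots.toFinset := by
      intro x hx
      rw [Multiset.mem_toFinset, mem_roots hf.ne_zero]
      exact (Finset.mem_filter.1 hx).2
    exact_mod_cast (Finset.card_le_card this).trans
      ((Multiset.toFinset_card_le _).trans (card_roots' _))
  have hcardF : (Fintype.card F : ℤ) = l * l := by rw [hF, hl2]; push_cast; rfl
  have hl1 : (1 : ℤ) ≤ l := by exact_mod_cast (by omega : 1 ≤ l)
  have hDl : (D : ℤ) ≤ D * l := le_mul_of_one_le_right (by positivity) hl1
  have hz0 : (0 : ℤ) ≤ ((Finset.univ.filter fun x : F => f.eval x = 0).card : ℤ) := by positivity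
  have hcast : ((p : ℤ) ^ s) = l := by rw [hl]; push_cast; rfl
  rw [hcast, abs_le]
  constructor
  · rw [Finset.sum_congr rfl fun x _ => (hpt x).2, Finset.sum_sub_distrib, Finset.sum_sub_distrib,
      ← Finset.mul_sum, Finset.sum_boole, Finset.sum_boole]
    simp only [Finset.sum_const, Finset.card_univ, nsmul_eq_mul, mul_one]
    linarith [key (-1)]
  · rw [Finset.sum_congr rfl fun x _ => (hpt x).1, Finset.sum_add_distrib, Finset.sum_sub_distrib,
      ← Finset.mul_sum, Finset.sum_boole, Finset.sum_boole]
    simp only [Finset.sum_const, Finset.card_univ, nsmul_eq_mul, mul_one]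
    linarith [key 1]

/-- Weil bound for hyperelliptic character sums over large finite fields of square order, with an
inexplicit order of magnitude in the degree. -/
lemma abs_sum_quadraticChar_le {F : Type*} [Field F] [Fintype F] [DecidableEq F]
    (p : ℕ) [Fact p.Prime] [CharP F p] (hp2 : p ≠ 2) {s : ℕ}
    (hF : Fintype.card F = p ^ (2 * s)) {f : F[X]} (hf : f.Separable)
    (hd : 0 < f.natDegree) (hs : 2 * f.natDegree + 2 ≤ p ^ s) :
    |∑ x, quadraticChar F (f.eval x)| ≤ (5 * f.natDegree + 6) * p ^ s := by
  obtain ⟨z, hz⟩ : ∃ z, f.eval z ≠ 0 := by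
    refine exists_eval_ne_zero_of_natDegree_lt_card f hf.ne_zero ?_
    rw [Cardinal.mk_fintype, hF]
    have h1 : f.natDegree < p ^ (2 * s) := by
      calc f.natDegree < p ^ s := by omega
        _ ≤ p ^ (2 * s) := Nat.pow_le_pow_right (Fact.out : p.Prime).pos (by omega)
    exact_mod_cast h1
  have hdeg : (f.comp (X + C z)).natDegree = f.natDegree := by rw [natDegree_comp]; simp
  have h := abs_sum_quadraticChar_le_of_eval_zero_ne p hp2 hF (f := f.comp (X + C z))
    (separable_comp_of_isUnit_derivative hf (by simp)) (by rwa [hdeg])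
    (by rw [coeff_zero_eq_eval_zero]; simpa using hz) (by rwa [hdeg])
  rw [hdeg] at h
  convert h using 2
  simp only [eval_comp, eval_add, eval_X, eval_C]
  exact (Fintype.sum_equiv (Equiv.addRight z) _ _ fun x => rfl).symm

lemma quadraticChar_norm {K L : Type*} [Field K] [Field L] [Fintype K] [Fintype L] [DecidableEq K]
    [DecidableEq L] [Algebra K L] (hK : ringChar K ≠ 2) (y : L) :
    quadraticChar K (Algebra.norm K y) = quadraticChar L y := by
  have hL : ringChar L ≠ 2 := by rwa [← Algebra.ringChar_eq K L]
  have h1 := congrArg (algebraMap K L)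
    (quadraticChar_eq_pow_of_char_ne_two' hK (Algebra.norm K y))
  rw [map_pow, FiniteField.algebraMap_norm_eq_pow, map_intCast, ← pow_mul] at h1
  have h2 := quadraticChar_eq_pow_of_char_ne_two' hL y
  have hexp : (Nat.card L - 1) / (Nat.card K - 1) * (Fintype.card K / 2) = Fintype.card L / 2 := by
    rw [Nat.card_eq_fintype_card, Nat.card_eq_fintype_card]
    have hk := FiniteField.odd_card_of_char_ne_two hK
    have hl := FiniteField.odd_card_of_char_ne_two hL
    have hk1 := Fintype.one_lt_card (α := K)
    have hdvd : Fintype.card K - 1 ∣ Fintype.card L - 1 := by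
      rw [Module.card_eq_pow_finrank (K := K) (V := L)]
      simpa using Nat.sub_dvd_pow_sub_pow (Fintype.card K) 1 (Module.finrank K L)
    obtain ⟨c, hc⟩ := hdvd
    rw [hc, Nat.mul_div_cancel_left _ (by omega)]
    obtain ⟨a, ha⟩ : ∃ a, Fintype.card K = 2 * a + 1 := ⟨Fintype.card K / 2, by omega⟩
    obtain ⟨b, hb⟩ : ∃ b, Fintype.card L = 2 * b + 1 := ⟨Fintype.card L / 2, by omega⟩
    have e1 : Fintype.card K - 1 = 2 * a := by omega
    have e2 : Fintype.card K / 2 = a := by omega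
    have e3 : Fintype.card L / 2 = b := by omega
    rw [e1] at hc
    rw [e2, e3]
    have : 2 * b = 2 * (c * a) := by rw [show 2 * b = Fintype.card L - 1 by omega, hc]; ring
    omega
  rw [hexp] at h1
  refine Int.cast_injOn_of_ringChar_ne_two hL ?_ ?_ (h1.trans h2.symm)
  · by_cases h : Algebra.norm K y = 0
    · simp [h]
    · rcases quadraticChar_dichotomy h with h | h <;> simp [h]
  · by_cases h : y = 0
    · simp [h]
    · rcases quadraticChar_dichotomy h with h | h <;> simp [h]

/-- The Artin–Schreier averaging trick: a mixed character sum is bounded by pure ones. -/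
lemma norm_sum_quadraticChar_mul_addChar_le {F : Type*} [Field F] [Fintype F] [DecidableEq F]
    (p : ℕ) [Fact p.Prime] [Algebra (ZMod p) F] (hp2 : p ≠ 2) {s : ℕ}
    (hF : Fintype.card F = p ^ (2 * s)) (R : Finset (ZMod p)) (hR : R.Nonempty)
    (hs : 2 * (R.card * p) + 2 ≤ p ^ s) (ψ : AddChar (ZMod p) ℂ) :
    ‖∑ x : F, (quadraticChar F (∏ c ∈ R, (algebraMap (ZMod p) F c - x)) : ℂ)
      * ψ (Algebra.trace (ZMod p) F x)‖ ≤ (5 * (R.card * p : ℕ) + 6) * (p : ℝ) ^ s := by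
  have hp := (Fact.out : p.Prime)
  have : CharP F p := charP_of_injective_algebraMap (algebraMap (ZMod p) F).injective p
  set B : ℝ := (5 * (R.card * p : ℕ) + 6) * (p : ℝ) ^ s with hB
  set G : F → ℤ := fun x => quadraticChar F (∏ c ∈ R, (algebraMap (ZMod p) F c - x)) with hG
  have htr (z : F) : Algebra.trace (ZMod p) F (z ^ p - z) = 0 := by
    rw [map_sub, sub_eq_zero]
    have := Algebra.trace_eq_of_algEquiv
      (FiniteField.frobeniusAlgEquivOfAlgebraic (ZMod p) F) z
    rwa [FiniteField.frobeniusAlgEquivOfAlgebraic_apply, ZMod.card] at this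
  have hpure (x : F) : ‖∑ z : F, (G (x + (z ^ p - z)) : ℂ)‖ ≤ B := by
    set u : F[X] := X - X ^ p - C x with hu
    set f : F[X] := ∏ c ∈ R, (X - C (-algebraMap (ZMod p) F c)) with hf
    have hfs : f.Separable := by
      rw [hf, separable_prod_X_sub_C_iff']
      intro a _ b _ hab
      exact (algebraMap (ZMod p) F).injective (neg_injective hab)
    have hfd : f.natDegree = R.card := by
      rw [hf, natDegree_prod_of_monic _ _ fun c _ => monic_X_sub_C _]
      simp
    have hud : u.natDegree = p := by
      have h1 : u = -(X ^ p - (X - C x)) := by rw [hu]; ring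
      rw [h1, natDegree_neg, natDegree_sub_eq_left_of_natDegree_lt, natDegree_X_pow]
      rw [natDegree_X_sub_C, natDegree_X_pow]
      exact hp.one_lt
    have hdeg : (f.comp u).natDegree = R.card * p := by rw [natDegree_comp, hfd, hud]
    have h := abs_sum_quadraticChar_le p hp2 hF (f := f.comp u)
      (separable_comp_of_isUnit_derivative hfs (by simp [hu, derivative_X_pow]))
      (by rw [hdeg]; exact Nat.mul_pos hR.card_pos hp.pos) (by rwa [hdeg])
    rw [hdeg] at h
    have h2 : ∑ z : F, (G (x + (z ^ p - z)) : ℂ)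
        = ((∑ z, quadraticChar F ((f.comp u).eval z) : ℤ) : ℂ) := by
      push_cast
      refine Finset.sum_congr rfl fun z _ => ?_
      rw [hG, hf, hu]
      simp only [eval_comp, eval_prod, eval_sub, eval_X, eval_C, eval_pow]
      congr 3
      funext c
      ring
    rw [h2, Complex.norm_intCast]
    rw [hB]
    exact_mod_cast h
  set S := ∑ x : F, (G x : ℂ) * ψ (Algebra.trace (ZMod p) F x) with hS
  have hshift (z : F) : ∑ x : F, (G (x + (z ^ p - z)) : ℂ) * ψ (Algebra.trace (ZMod p) F x) = S := by
    refine Fintype.sum_equiv (Equiv.addRight (z ^ p - z)) _ _ fun x => ?_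
    simp only [Equiv.coe_addRight, map_add, htr, add_zero]
  have hsum : (Fintype.card F : ℂ) * S
      = ∑ x : F, (∑ z : F, (G (x + (z ^ p - z)) : ℂ)) * ψ (Algebra.trace (ZMod p) F x) := by
    simp only [Finset.sum_mul]
    rw [Finset.sum_comm, Finset.sum_congr rfl fun z _ => hshift z]
    simp
  have hq : (0 : ℝ) < Fintype.card F := by exact_mod_cast Fintype.card_pos
  have hle : (Fintype.card F : ℝ) * ‖S‖ ≤ Fintype.card F * B := by
    calc (Fintype.card F : ℝ) * ‖S‖ = ‖(Fintype.card F : ℂ) * S‖ := by simp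
      _ ≤ ∑ x : F, B := by
        rw [hsum]
        refine norm_sum_le_of_le _ fun x _ => ?_
        rw [norm_mul, AddChar.norm_apply, mul_one]
        exact hpure x
      _ = Fintype.card F * B := by simp
  exact le_of_mul_le_mul_left hle hq

end

section

open Polynomial

/-- The characteristic polynomial of an element `x` of a finite extension, as a power of its
minimal polynomial. -/
noncomputable def minpolyPow (K : Type*) {L : Type*} [Field K] [Field L] [Algebra K L] (x : L) :
    K[X] :=
  minpoly K x ^ (Module.finrank K L / (minpoly K x).natDegree)

section MinpolyPow

variable {K L : Type*} [Field K] [Field L] [Algebra K L] [FiniteDimensional K L]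

lemma monic_minpolyPow (x : L) : (minpolyPow K x).Monic :=
  (minpoly.monic (Algebra.IsIntegral.isIntegral x)).pow _

lemma natDegree_minpoly_mul_finrank (x : L) :
    (minpoly K x).natDegree * Module.finrank (IntermediateField.adjoin K {x}) L
      = Module.finrank K L := by
  rw [← IntermediateField.adjoin.finrank (Algebra.IsIntegral.isIntegral x)]
  exact Module.finrank_mul_finrank _ _ _

lemma finrank_div_natDegree_minpoly (x : L) :
    Module.finrank K L / (minpoly K x).natDegree
      = Module.finrank (IntermediateField.adjoin K {x}) L := by
  rw [← natDegree_minpoly_mul_finrank (K := K) x,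
    Nat.mul_div_cancel_left _ (minpoly.natDegree_pos (Algebra.IsIntegral.isIntegral x))]

lemma natDegree_minpolyPow (x : L) : (minpolyPow K x).natDegree = Module.finrank K L := by
  rw [minpolyPow, natDegree_pow, finrank_div_natDegree_minpoly, mul_comm,
    natDegree_minpoly_mul_finrank]

lemma neg_nextCoeff_minpolyPow (x : L) :
    -(minpolyPow K x).nextCoeff = Algebra.trace K L x := by
  rw [trace_eq_finrank_mul_minpoly_nextCoeff, minpolyPow, finrank_div_natDegree_minpoly,
    (minpoly.monic (Algebra.IsIntegral.isIntegral x)).nextCoeff_pow]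
  simp

lemma norm_eq_pow_minpoly_coeff_zero (x : L) :
    Algebra.norm K x = (-1) ^ Module.finrank K L *
      (minpoly K x).coeff 0 ^ Module.finrank (IntermediateField.adjoin K {x}) L := by
  have hx : IsIntegral K x := Algebra.IsIntegral.isIntegral x
  have h := Algebra.PowerBasis.norm_gen_eq_coeff_zero_minpoly
    (IntermediateField.adjoin.powerBasis hx)
  rw [IntermediateField.adjoin.powerBasis_gen hx, IntermediateField.minpoly_gen,
    IntermediateField.adjoin.powerBasis_dim] at h
  rw [Algebra.norm_eq_norm_adjoin, h, mul_pow, ← pow_mul, natDegree_minpoly_mul_finrank]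

lemma eval_minpolyPow (x : L) (c : K) :
    (minpolyPow K x).eval c = Algebra.norm K (algebraMap K L c - x) := by
  have h1 : minpoly K (x - algebraMap K L c) = (minpoly K x).comp (X + C c) :=
    minpoly.sub_algebraMap x c
  have h2 : algebraMap K L c - x = algebraMap K L (-1) * (x - algebraMap K L c) := by simp
  have h3 : Module.finrank (IntermediateField.adjoin K {x - algebraMap K L c}) L
      = Module.finrank (IntermediateField.adjoin K {x}) L := by
    rw [← finrank_div_natDegree_minpoly, ← finrank_div_natDegree_minpoly, h1, natDegree_comp,
      natDegree_X_add_C, mul_one]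
  rw [h2, map_mul, Algebra.norm_algebraMap, norm_eq_pow_minpoly_coeff_zero, h3, h1,
    coeff_zero_eq_eval_zero, ← mul_assoc, ← mul_pow]
  simp [minpolyPow, finrank_div_natDegree_minpoly]

end MinpolyPow

section Count

variable (p : ℕ) [Fact p.Prime]

noncomputable instance (k : ℕ) : Fintype (GaloisField p k) := Fintype.ofFinite _

open Classical in
lemma card_filter_minpoly_eq {k : ℕ} (hk : k ≠ 0) {Q : (ZMod p)[X]} (hQ : Irreducible Q)
    (hm : Q.Monic) (hdvd : Q.natDegree ∣ k) :
    (Finset.univ.filter fun x : GaloisField p k => minpoly (ZMod p) x = Q).card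
      = Q.natDegree := by
  have hsep : Q.Separable := PerfectField.separable_of_irreducible hQ
  have hs : Splits (Q.map (algebraMap (ZMod p) (GaloisField p k))) := by
    have h1 := hQ.natDegree_dvd_iff_dvd_X_pow_card_pow_sub_X.1 hdvd
    rw [Nat.card_zmod] at h1
    refine Splits.of_dvd ?_ ?_ (map_dvd (algebraMap (ZMod p) (GaloisField p k)) h1)
    · exact (FiniteField.isSplittingField_of_nat_card_eq (K := GaloisField p k) p k
        (GaloisField.card p k hk)).splits
    · exact map_ne_zero (FiniteField.X_pow_card_pow_sub_X_ne_zero _ hk (Fact.out : p.Prime).one_lt)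
  rw [← card_rootSet_eq_natDegree hsep hs, ← Set.toFinset_card]
  congr 1
  ext x
  rw [Finset.mem_filter, Set.mem_toFinset, mem_rootSet_of_ne hQ.ne_zero]
  constructor
  · rintro ⟨-, rfl⟩
    exact minpoly.aeval _ _
  · intro h
    exact ⟨Finset.mem_univ _, (minpoly.eq_of_irreducible_of_monic hQ h hm).symm⟩

lemma minpolyPow_dvd_mul_iff {k : ℕ} (x : GaloisField p k) {a b : (ZMod p)[X]}
    (hab : IsRelPrime a b) :
    minpolyPow (ZMod p) x ∣ a * b ↔ minpolyPow (ZMod p) x ∣ a ∨ minpolyPow (ZMod p) x ∣ b := by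
  constructor
  · intro h
    have hP : Prime (minpoly (ZMod p) x) := minpoly.prime (Algebra.IsIntegral.isIntegral x)
    by_cases ha : minpoly (ZMod p) x ∣ a
    · left
      have hb : ¬ minpoly (ZMod p) x ∣ b := fun hb => hP.not_isUnit (hab ha hb)
      refine IsRelPrime.dvd_of_dvd_mul_right ?_ h
      exact ((hP.irreducible.isRelPrime_iff_not_dvd).2 hb).pow_left
    · right
      refine IsRelPrime.dvd_of_dvd_mul_left ?_ h
      exact ((hP.irreducible.isRelPrime_iff_not_dvd).2 ha).pow_left
  · rintro (h | h)
    · exact h.mul_right _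
    · exact h.mul_left _

lemma minpolyPow_dvd_prime_pow_iff {k : ℕ} (hk : k ≠ 0) (x : GaloisField p k) {Q : (ZMod p)[X]}
    (hQ : Irreducible Q) (hm : Q.Monic) (i : ℕ) :
    minpolyPow (ZMod p) x ∣ Q ^ i ↔ minpoly (ZMod p) x = Q ∧ k / Q.natDegree ≤ i := by
  have hx : IsIntegral (ZMod p) x := Algebra.IsIntegral.isIntegral x
  have hfin := finrank_div_natDegree_minpoly (K := ZMod p) x
  have hpos : 0 < Module.finrank (IntermediateField.adjoin (ZMod p) {x}) (GaloisField p k) :=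
    Module.finrank_pos
  rw [GaloisField.finrank p hk] at hfin
  have hpow : minpolyPow (ZMod p) x = minpoly (ZMod p) x ^ (k / (minpoly (ZMod p) x).natDegree) := by
    rw [minpolyPow, GaloisField.finrank p hk]
  rw [hpow]
  constructor
  · intro h
    have hP : Prime (minpoly (ZMod p) x) := minpoly.prime hx
    have h1 : minpoly (ZMod p) x ∣ Q :=
      hP.dvd_of_dvd_pow ((dvd_pow_self _ (by omega)).trans h)
    have h2 : minpoly (ZMod p) x = Q :=
      eq_of_monic_of_associated (minpoly.monic hx) hm
        (hP.irreducible.associated_of_dvd hQ h1)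
    refine ⟨h2, ?_⟩
    rw [h2] at h
    exact (pow_dvd_pow_iff hQ.ne_zero hQ.not_isUnit).1 h
  · rintro ⟨h2, h3⟩
    rw [h2]
    exact pow_dvd_pow _ h3

open Classical in
lemma sum_card_filter_minpolyPow_dvd {g : (ZMod p)[X]} (hg : g ≠ 0) {n : ℕ}
    (hn : g.natDegree ≤ n) :
    ∑ k ∈ Finset.Icc 1 n, (Finset.univ.filter fun x : GaloisField p k =>
      minpolyPow (ZMod p) x ∣ g).card = g.natDegree := by
  induction g using UniqueFactorizationMonoid.induction_on_coprime with
  | h0 => exact absurd rfl hg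
  | @h1 u hu =>
    rw [natDegree_eq_zero_of_isUnit hu, Finset.sum_eq_zero]
    intro k hk
    rw [Finset.card_eq_zero, Finset.filter_eq_empty_iff]
    intro x _ hdvd
    have h1 := natDegree_eq_zero_of_isUnit (isUnit_of_dvd_unit hdvd hu)
    rw [natDegree_minpolyPow, GaloisField.finrank p (by simp at hk; omega)] at h1
    simp at hk; omega
  | @hpr q i hq =>
    have hq0 : q ≠ 0 := hq.ne_zero
    set Q := normalize q with hQ
    have hQm : Q.Monic := monic_normalize hq0
    have hQi : Irreducible Q := (associated_normalize q).irreducible hq.irreducible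
    have hQd : Q.natDegree = q.natDegree := natDegree_eq_of_degree_eq (degree_normalize)
    have hdvd (G : (ZMod p)[X]) : G ∣ q ^ i ↔ G ∣ Q ^ i :=
      ((associated_normalize q).pow_pow).dvd_iff_dvd_right
    simp only [hdvd]
    rw [natDegree_pow, ← hQd] at hn ⊢
    have hd : 0 < Q.natDegree := hQi.natDegree_pos
    have hterm : ∀ k ∈ Finset.Icc 1 n, (Finset.univ.filter fun x : GaloisField p k =>
        minpolyPow (ZMod p) x ∣ Q ^ i).card
        = if Q.natDegree ∣ k ∧ k / Q.natDegree ≤ i then Q.natDegree else 0 := by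
      intro k hk
      have hk0 : k ≠ 0 := by simp at hk; omega
      simp only [minpolyPow_dvd_prime_pow_iff p hk0 _ hQi hQm]
      split_ifs with h
      · simp only [h.2, and_true]
        exact card_filter_minpoly_eq p hk0 hQi hQm h.1
      · rw [Finset.card_eq_zero, Finset.filter_eq_empty_iff]
        rintro x - ⟨h1, h2⟩
        refine h ⟨?_, h2⟩
        have h3 := natDegree_minpoly_mul_finrank (K := ZMod p) x
        rw [GaloisField.finrank p hk0] at h3
        rw [← h1]
        exact Dvd.intro _ h3
    rw [Finset.sum_congr rfl hterm, ← Finset.sum_filter, Finset.sum_const, smul_eq_mul]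
    congr 1
    have : (Finset.Icc 1 n).filter (fun k => Q.natDegree ∣ k ∧ k / Q.natDegree ≤ i)
        = (Finset.Icc 1 i).image (fun j => Q.natDegree * j) := by
      ext k
      simp only [Finset.mem_filter, Finset.mem_Icc, Finset.mem_image]
      constructor
      · rintro ⟨⟨h1, h2⟩, ⟨j, rfl⟩, h4⟩
        rw [Nat.mul_div_cancel_left _ hd] at h4
        exact ⟨j, ⟨Nat.pos_of_ne_zero (by rintro rfl; simp at h1), h4⟩, rfl⟩
      · rintro ⟨j, ⟨h1, h2⟩, rfl⟩
        refine ⟨⟨Nat.mul_pos hd h1, ?_⟩, Dvd.intro _ rfl, by rwa [Nat.mul_div_cancel_left _ hd]⟩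
        calc Q.natDegree * j ≤ Q.natDegree * i := Nat.mul_le_mul_left _ h2
          _ ≤ n := by rwa [mul_comm]
    rw [this, Finset.card_image_of_injective _ (mul_right_injective₀ hd.ne')]
    simp
  | @hcp a b hab iha ihb =>
    have ha : a ≠ 0 := left_ne_zero_of_mul hg
    have hb : b ≠ 0 := right_ne_zero_of_mul hg
    rw [natDegree_mul ha hb] at hn ⊢
    rw [← iha ha (by omega), ← ihb hb (by omega), ← Finset.sum_add_distrib]
    refine Finset.sum_congr rfl fun k hk => ?_
    rw [← Finset.card_union_of_disjoint, ← Finset.filter_or]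
    · simp only [minpolyPow_dvd_mul_iff p _ hab]
    · rw [Finset.disjoint_filter]
      intro x _ h1 h2
      have h3 := natDegree_eq_zero_of_isUnit (hab h1 h2)
      rw [natDegree_minpolyPow, GaloisField.finrank p (by simp at hk; omega)] at h3
      simp at hk; omega

end Count

end

section

open Polynomial

section LFunction

variable {p : ℕ} [Fact p.Prime]

/-- The completely multiplicative function on monic polynomials attached to the quadratic
character twisted by the values at the points of `R`, and to an additive character. -/
noncomputable def twist (R : Finset (ZMod p)) (ψ : AddChar (ZMod p) ℂ) (g : (ZMod p)[X]) : ℂ :=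
  (quadraticChar (ZMod p) (∏ c ∈ R, g.eval c) : ℂ) * ψ (-g.nextCoeff)

lemma twist_one (R : Finset (ZMod p)) (ψ : AddChar (ZMod p) ℂ) : twist R ψ 1 = 1 := by
  have : (1 : (ZMod p)[X]).nextCoeff = 0 := nextCoeff_C_eq_zero (1 : ZMod p)
  simp [twist, this]

lemma twist_mul (R : Finset (ZMod p)) (ψ : AddChar (ZMod p) ℂ) {g h : (ZMod p)[X]}
    (hg : g.Monic) (hh : h.Monic) : twist R ψ (g * h) = twist R ψ g * twist R ψ h := by
  simp only [twist, eval_mul, Finset.prod_mul_distrib, map_mul, hg.nextCoeff_mul hh, neg_add,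
    AddChar.map_add_eq_mul]
  push_cast
  ring

lemma finite_monic_natDegree (n : ℕ) :
    {g : (ZMod p)[X] | g.Monic ∧ g.natDegree = n}.Finite := by
  have : Finite (degreeLT (ZMod p) (n + 1)) :=
    Finite.of_equiv _ (degreeLTEquiv (ZMod p) (n + 1)).symm.toEquiv
  refine (Set.toFinite (degreeLT (ZMod p) (n + 1) : Set (ZMod p)[X])).subset ?_
  rintro g ⟨-, hg⟩
  exact mem_degreeLT_of_natDegree_lt (by omega)

/-- The finite set of monic polynomials of degree `n`. -/
noncomputable def monicFinset (p : ℕ) [Fact p.Prime] (n : ℕ) : Finset (ZMod p)[X] :=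
  (finite_monic_natDegree n).toFinset

lemma mem_monicFinset {n : ℕ} {g : (ZMod p)[X]} :
    g ∈ monicFinset p n ↔ g.Monic ∧ g.natDegree = n := by
  simp [monicFinset]

lemma sum_twist_monicFinset_zero (R : Finset (ZMod p)) (ψ : AddChar (ZMod p) ℂ) :
    ∑ g ∈ monicFinset p 0, twist R ψ g = 1 := by
  have : monicFinset p 0 = {1} := by
    ext g
    rw [mem_monicFinset, Finset.mem_singleton]
    constructor
    · rintro ⟨h1, h2⟩
      exact h1.natDegree_eq_zero.1 h2
    · rintro rfl
      simp
  rw [this, Finset.sum_singleton, twist_one]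

lemma sum_twist_monicFinset_one (R : Finset (ZMod p)) (ψ : AddChar (ZMod p) ℂ) :
    ∑ g ∈ monicFinset p 1, twist R ψ g
      = ∑ a : ZMod p, (quadraticChar (ZMod p) (∏ c ∈ R, (c - a)) : ℂ) * ψ a := by
  symm
  refine Finset.sum_bij (fun a _ => X - C a) ?_ ?_ ?_ ?_
  · intro a _
    exact mem_monicFinset.2 ⟨monic_X_sub_C a, natDegree_X_sub_C a⟩
  · intro a _ b _ h
    simpa using h
  · intro g hg
    obtain ⟨h1, h2⟩ := mem_monicFinset.1 hg
    refine ⟨-g.coeff 0, Finset.mem_univ _, ?_⟩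
    rw [h1.eq_X_add_C h2]
    simp
  · intro a _
    simp [twist, nextCoeff_X_sub_C]

lemma sum_twist_monicFinset_eq_zero (hp2 : p ≠ 2) {R : Finset (ZMod p)} (hR : R.Nonempty)
    (ψ : AddChar (ZMod p) ℂ) {n : ℕ} (hn : R.card < n) :
    ∑ g ∈ monicFinset p n, twist R ψ g = 0 := by
  obtain ⟨c₀, hc₀⟩ := hR
  set h : (ZMod p)[X] := ∏ c ∈ R.erase c₀, (X - C c) with hh
  have hdeg : h.natDegree + 1 = R.card := by
    rw [hh, natDegree_prod_of_monic _ _ fun c _ => monic_X_sub_C c]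
    simp only [natDegree_X_sub_C, Finset.sum_const, smul_eq_mul, mul_one]
    exact Finset.card_erase_add_one hc₀
  have hmem (t : ZMod p) {g : (ZMod p)[X]} (hg : g ∈ monicFinset p n) :
      g + C t * h ∈ monicFinset p n := by
    obtain ⟨h1, h2⟩ := mem_monicFinset.1 hg
    have hlt : (C t * h).degree < g.degree := by
      refine degree_lt_degree (lt_of_le_of_lt (natDegree_C_mul_le t h) ?_)
      omega
    exact mem_monicFinset.2 ⟨h1.add_of_left hlt, by rw [natDegree_add_eq_left_of_degree_lt hlt, h2]⟩
  have hval (t : ZMod p) {g : (ZMod p)[X]} (hg : g ∈ monicFinset p n) :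
      twist R ψ (g + C t * h) = (quadraticChar (ZMod p) (g.eval c₀ + t * h.eval c₀) : ℂ) *
        ((quadraticChar (ZMod p) (∏ c ∈ R.erase c₀, g.eval c) : ℂ) * ψ (-g.nextCoeff)) := by
    have h1 : (g + C t * h).nextCoeff = g.nextCoeff := by
      have h2 := (mem_monicFinset.1 hg).2
      have h3 := (mem_monicFinset.1 (hmem t hg)).2
      rw [nextCoeff_of_natDegree_pos (by omega), nextCoeff_of_natDegree_pos (by omega), h2, h3,
        coeff_add, coeff_C_mul, coeff_eq_zero_of_natDegree_lt (by omega : h.natDegree < n - 1)]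
      simp
    have h4 : ∏ c ∈ R.erase c₀, (g + C t * h).eval c = ∏ c ∈ R.erase c₀, g.eval c := by
      refine Finset.prod_congr rfl fun c hc => ?_
      have : h.eval c = 0 := by
        rw [hh, eval_prod]
        exact Finset.prod_eq_zero hc (by simp)
      simp [this]
    rw [twist, h1, ← Finset.mul_prod_erase R _ hc₀, h4, map_mul]
    simp only [eval_add, eval_mul, eval_C]
    push_cast
    ring
  have hne : h.eval c₀ ≠ 0 := by
    rw [hh, eval_prod, Finset.prod_ne_zero_iff]
    intro c hc
    simpa [sub_eq_zero] using (Finset.ne_of_mem_erase hc).symm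
  have hshift (t : ZMod p) : ∑ g ∈ monicFinset p n, twist R ψ g
      = ∑ g ∈ monicFinset p n, twist R ψ (g + C t * h) := by
    refine Finset.sum_bij' (fun g _ => g + C (-t) * h) (fun g _ => g + C t * h)
      (fun g hg => hmem _ hg) (fun g hg => hmem _ hg) ?_ ?_ ?_
    · intro g _
      simp
    · intro g _
      simp
    · intro g _
      simp
  have hsum (g : (ZMod p)[X]) :
      ∑ t : ZMod p, (quadraticChar (ZMod p) (g.eval c₀ + t * h.eval c₀) : ℂ) = 0 := by
    have h2 : ringChar (ZMod p) ≠ 2 := by rwa [ZMod.ringChar_zmod_n]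
    have h3 := quadraticChar_sum_zero h2
    rw [← Equiv.sum_comp ((Equiv.mulRight₀ _ hne).trans (Equiv.addLeft (g.eval c₀)))] at h3
    exact_mod_cast h3
  have hp0 : (p : ℂ) ≠ 0 := by exact_mod_cast (Fact.out : p.Prime).ne_zero
  refine (mul_eq_zero.1 (?_ : (p : ℂ) * _ = 0)).resolve_left hp0
  calc (p : ℂ) * ∑ g ∈ monicFinset p n, twist R ψ g
      = ∑ t : ZMod p, ∑ g ∈ monicFinset p n, twist R ψ (g + C t * h) := by
        simp only [← hshift]
        simp [ZMod.card]
    _ = ∑ g ∈ monicFinset p n, ∑ t : ZMod p, twist R ψ (g + C t * h) := Finset.sum_comm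
    _ = 0 := by
        refine Finset.sum_eq_zero fun g hg => ?_
        simp only [hval _ hg]
        rw [← Finset.sum_mul, hsum, zero_mul]

lemma natCast_mul_sum_twist_monicFinset (R : Finset (ZMod p)) (ψ : AddChar (ZMod p) ℂ) (n : ℕ) :
    (n : ℂ) * ∑ g ∈ monicFinset p n, twist R ψ g
      = ∑ k ∈ Finset.Icc 1 n, (∑ x : GaloisField p k, twist R ψ (minpolyPow (ZMod p) x)) *
        ∑ g ∈ monicFinset p (n - k), twist R ψ g := by
  classical
  have h1 : ∀ g ∈ monicFinset p n, (n : ℂ) * twist R ψ g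
      = ∑ k ∈ Finset.Icc 1 n, ∑ x : GaloisField p k,
          if minpolyPow (ZMod p) x ∣ g then twist R ψ g else 0 := by
    intro g hg
    obtain ⟨hm, hd⟩ := mem_monicFinset.1 hg
    have h2 := sum_card_filter_minpolyPow_dvd p hm.ne_zero hd.le
    rw [hd] at h2
    conv_lhs => rw [← h2]
    push_cast
    rw [Finset.sum_mul]
    refine Finset.sum_congr rfl fun k _ => ?_
    rw [← Finset.sum_filter, Finset.sum_const, nsmul_eq_mul]
  rw [Finset.mul_sum, Finset.sum_congr rfl h1, Finset.sum_comm]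
  refine Finset.sum_congr rfl fun k hk => ?_
  rw [Finset.mem_Icc] at hk
  rw [Finset.sum_comm, Finset.sum_mul]
  refine Finset.sum_congr rfl fun x _ => ?_
  rw [← Finset.sum_filter, Finset.mul_sum]
  have hx := monic_minpolyPow (K := ZMod p) x
  have hxd := natDegree_minpolyPow (K := ZMod p) x
  rw [GaloisField.finrank p (by omega)] at hxd
  symm
  refine Finset.sum_bij (fun g _ => minpolyPow (ZMod p) x * g) ?_ ?_ ?_ ?_
  · intro g hg
    obtain ⟨hm, hd⟩ := mem_monicFinset.1 hg
    rw [Finset.mem_filter, mem_monicFinset]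
    refine ⟨⟨hx.mul hm, ?_⟩, Dvd.intro _ rfl⟩
    rw [hx.natDegree_mul hm, hxd, hd]
    omega
  · intro a _ b _ hab
    exact mul_left_cancel₀ hx.ne_zero hab
  · intro g hg
    rw [Finset.mem_filter, mem_monicFinset] at hg
    obtain ⟨⟨hm, hd⟩, f, rfl⟩ := hg
    have hf := hx.of_mul_monic_left hm
    rw [hx.natDegree_mul hf, hxd] at hd
    exact ⟨f, mem_monicFinset.2 ⟨hf, by omega⟩, rfl⟩
  · intro g hg
    exact (twist_mul R ψ hx (mem_monicFinset.1 hg).1).symm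

open Classical in
lemma twist_minpolyPow (hp2 : p ≠ 2) (R : Finset (ZMod p)) (ψ : AddChar (ZMod p) ℂ) {k : ℕ}
    (x : GaloisField p k) :
    twist R ψ (minpolyPow (ZMod p) x)
      = (quadraticChar (GaloisField p k)
          (∏ c ∈ R, (algebraMap (ZMod p) (GaloisField p k) c - x)) : ℂ)
        * ψ (Algebra.trace (ZMod p) (GaloisField p k) x) := by
  have h2 : ringChar (ZMod p) ≠ 2 := by rwa [ZMod.ringChar_zmod_n]
  simp only [twist, eval_minpolyPow, neg_nextCoeff_minpolyPow]
  rw [← quadraticChar_norm (L := GaloisField p k) h2, map_prod, map_prod, map_prod]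

end LFunction

end

section

open Polynomial

/-- If `A` is the coefficient sequence of a polynomial of degree at most `d` with constant term
one, and `S` is given by its logarithmic derivative, then `-S` is a sum of `d` pure powers. -/
lemma exists_eq_neg_sum_pow {d : ℕ} {A S : ℕ → ℂ} (hA0 : A 0 = 1) (hA : ∀ n : ℕ, d < n → A n = 0)
    (hrec : ∀ n : ℕ, (n : ℂ) * A n = ∑ k ∈ Finset.Icc 1 n, S k * A (n - k)) :
    ∃ ω : Fin d → ℂ, ∀ k : ℕ, 1 ≤ k → S k = -∑ i, ω i ^ k := by
  set P : ℂ[X] := ∑ i ∈ Finset.range (d + 1), C (A (d - i)) * X ^ i with hP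
  have hcoeff (i : ℕ) (hi : i ≤ d) : P.coeff i = A (d - i) := by
    rw [hP, finsetSum_coeff]
    simp only [coeff_C_mul_X_pow]
    rw [Finset.sum_ite_eq, if_pos (Finset.mem_range.2 (by omega))]
  have hle : P.natDegree ≤ d := by
    refine natDegree_sum_le_of_forall_le _ _ fun i hi => ?_
    exact (natDegree_C_mul_X_pow_le _ _).trans (by simpa [Nat.lt_succ_iff] using hi)
  have hlead : P.coeff d = 1 := by rw [hcoeff d le_rfl, Nat.sub_self, hA0]
  have hnat : P.natDegree = d := le_antisymm hle (le_natDegree_of_ne_zero (by simp [hlead]))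
  have hcard : P.roots.card = d := by rw [IsAlgClosed.card_roots_eq_natDegree, hnat]
  obtain ⟨ω, hω⟩ : ∃ ω : Fin d → ℂ, Multiset.map ω Finset.univ.val = P.roots := by
    generalize P.roots = s at hcard
    obtain ⟨l, rfl⟩ := Quot.exists_rep s
    change l.length = d at hcard
    subst hcard
    exact ⟨l.get, by rw [Fin.univ_val_map, List.ofFn_get]; rfl⟩
  have hAe (n : ℕ) : A n = (-1) ^ n * MvPolynomial.aeval ω (MvPolynomial.esymm (Fin d) ℂ n) := by
    rw [MvPolynomial.aeval_esymm_eq_multiset_esymm, hω]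
    rcases le_or_gt n d with hn | hn
    · have h1 := coeff_eq_esymm_roots_of_card (p := P) (hcard.trans hnat.symm)
        (k := d - n) (by omega)
      rw [hcoeff _ (by omega), hnat, leadingCoeff, hnat, hlead, one_mul] at h1
      rwa [show d - (d - n) = n by omega] at h1
    · rw [hA n hn, Multiset.esymm, Multiset.powersetCard_eq_empty _ (by omega)]
      simp
  refine ⟨ω, fun k => ?_⟩
  induction k using Nat.strong_induction_on with
  | _ k ih =>
    intro hk
    have h1 := congrArg (MvPolynomial.aeval ω) (MvPolynomial.mul_esymm_eq_sum (Fin d) ℂ k)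
    simp only [map_mul, map_sum, map_pow, map_natCast, map_neg, map_one] at h1
    have h2 : (k : ℂ) * A k = - ∑ j ∈ Finset.Icc 1 k, (∑ i, ω i ^ j) * A (k - j) := by
      rw [hAe k, mul_left_comm, h1, ← mul_assoc, ← pow_add]
      rw [show k + (k + 1) = 2 * k + 1 by ring, pow_succ, pow_mul]
      simp only [neg_one_sq, one_pow, one_mul, neg_mul, neg_inj]
      refine Finset.sum_nbij' (fun a => a.2) (fun j => (k - j, j)) ?_ ?_ ?_ ?_ ?_
      · rintro ⟨a, b⟩ hab
        simp only [Finset.mem_filter, Finset.HasAntidiagonal.mem_antidiagonal, Finset.mem_Icc] at hab ⊢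
        omega
      · intro j hj
        simp only [Finset.mem_filter, Finset.HasAntidiagonal.mem_antidiagonal, Finset.mem_Icc] at hj ⊢
        omega
      · rintro ⟨a, b⟩ hab
        simp only [Finset.mem_filter, Finset.HasAntidiagonal.mem_antidiagonal] at hab
        simp only [Prod.mk.injEq, and_true]
        omega
      · intro j _
        rfl
      · rintro ⟨a, b⟩ hab
        simp only [Finset.mem_filter, Finset.HasAntidiagonal.mem_antidiagonal] at hab
        rw [show k - b = a by omega, hAe a, MvPolynomial.psum]
        simp
        ring
    have h3 : ∑ j ∈ Finset.Icc 1 k, (S j + ∑ i, ω i ^ j) * A (k - j) = 0 := by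
      simp only [add_mul, Finset.sum_add_distrib]
      rw [← hrec k, h2, neg_add_cancel]
    rw [Finset.sum_eq_single_of_mem k (by simp [hk])] at h3
    · rw [Nat.sub_self, hA0, mul_one] at h3
      exact eq_neg_of_add_eq_zero_left h3
    · intro j hj hjk
      rw [Finset.mem_Icc] at hj
      rw [ih j (by omega) hj.1, neg_add_cancel, zero_mul]

end

section

open Polynomial

open Filter Topology in
/-- A bound for infinitely many even power sums bounds each of the summands. -/
lemma norm_sq_le_of_norm_sum_pow_le {ι : Type*} [Fintype ι] (ω : ι → ℂ) {B q : ℝ} (hq : 0 < q)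
    (h : ∀ᶠ s : ℕ in atTop, ‖∑ i, ω i ^ (2 * s)‖ ≤ B * q ^ s) (j : ι) : ‖ω j‖ ^ 2 ≤ q := by
  by_contra! hj
  let u : ι → Circle := fun i => Circle.exp (Complex.arg (ω i ^ 2))
  have hz (i : ι) (s : ℕ) : ω i ^ (2 * s) = ((‖ω i‖ ^ 2) ^ s : ℝ) * ((u ^ s) i : ℂ) := by
    conv_lhs => rw [pow_mul, ← Complex.norm_mul_exp_arg_mul_I (ω i ^ 2), mul_pow]
    simp [u, Circle.coe_exp, norm_pow]
  have hopen : {v : ι → Circle | ∀ i, 1 / 2 < (v i : ℂ).re} ∈ 𝓝 (1 : ι → Circle) := by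
    refine IsOpen.mem_nhds ?_ ?_
    · simp only [Set.ofPred_forall]
      refine isOpen_iInter_of_finite fun i => ?_
      exact isOpen_lt continuous_const
        (by fun_prop)
    · intro i
      norm_num
  have hfreq := (mapClusterPt_one_atTop_pow u).frequently hopen
  have hlim : Tendsto (fun s : ℕ => (‖ω j‖ ^ 2 / q) ^ s) atTop atTop :=
    tendsto_pow_atTop_atTop_of_one_lt ((one_lt_div hq).2 hj)
  obtain ⟨s, hs, h1, h2⟩ := (hfreq.and_eventually (h.and (hlim.eventually_gt_atTop (2 * B)))).exists
  have h3 : (‖ω j‖ ^ 2) ^ s / 2 ≤ ‖∑ i, ω i ^ (2 * s)‖ := by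
    refine le_trans ?_ (Complex.re_le_norm _)
    rw [Complex.re_sum]
    have h4 (i : ι) : (‖ω i‖ ^ 2) ^ s / 2 ≤ (ω i ^ (2 * s)).re := by
      rw [hz, Complex.re_ofReal_mul]
      have := (hs i).le
      have h5 : 0 ≤ (‖ω i‖ ^ 2) ^ s := by positivity
      nlinarith
    refine (h4 j).trans (Finset.single_le_sum (f := fun i => (ω i ^ (2 * s)).re) (fun i _ => ?_)
      (Finset.mem_univ j))
    exact le_trans (by positivity) (h4 i)
  rw [div_pow, lt_div_iff₀ (by positivity)] at h2
  linarith

/-- The Weil bound for mixed sums of the quadratic character and an additive character. -/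
theorem norm_sum_quadraticChar_mul_addChar_zmod_le {p : ℕ} [Fact p.Prime] (hp2 : p ≠ 2)
    {R : Finset (ZMod p)} (hR : R.Nonempty) (ψ : AddChar (ZMod p) ℂ) :
    ‖∑ a : ZMod p, (quadraticChar (ZMod p) (∏ c ∈ R, (c - a)) : ℂ) * ψ a‖
      ≤ R.card * Real.sqrt p := by
  classical
  have hp : p.Prime := Fact.out
  have hp0 : (0 : ℝ) < p := by exact_mod_cast hp.pos
  obtain ⟨ω, hω⟩ := exists_eq_neg_sum_pow (d := R.card)
    (A := fun n => ∑ g ∈ monicFinset p n, twist R ψ g)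
    (S := fun k => ∑ x : GaloisField p k, twist R ψ (minpolyPow (ZMod p) x))
    (sum_twist_monicFinset_zero R ψ)
    (fun n hn => sum_twist_monicFinset_eq_zero hp2 hR ψ hn)
    (natCast_mul_sum_twist_monicFinset R ψ)
  have hbig : ∀ᶠ s : ℕ in Filter.atTop,
      ‖∑ i, ω i ^ (2 * s)‖ ≤ (5 * (R.card * p : ℕ) + 6 : ℝ) * (p : ℝ) ^ s := by
    have h1 := (tendsto_pow_atTop_atTop_of_one_lt (r := p) hp.one_lt).eventually_ge_atTop
      (2 * (R.card * p) + 2)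
    filter_upwards [h1, Filter.eventually_ge_atTop 1] with s hs hs1
    have h2 := hω (2 * s) (by omega)
    have hcard : Fintype.card (GaloisField p (2 * s)) = p ^ (2 * s) := by
      rw [← Nat.card_eq_fintype_card, GaloisField.card p _ (by omega)]
    have h3 := norm_sum_quadraticChar_mul_addChar_le p hp2 hcard R hR hs ψ
    simp only [twist_minpolyPow hp2] at h2
    rw [h2, norm_neg] at h3
    exact h3
  have hnorm (i : Fin R.card) : ‖ω i‖ ≤ Real.sqrt p :=
    Real.le_sqrt_of_sq_le (norm_sq_le_of_norm_sum_pow_le ω hp0 hbig i)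
  have h1 := natCast_mul_sum_twist_monicFinset R ψ 1
  simp only [Nat.cast_one, one_mul, Finset.Icc_self, Finset.sum_singleton, Nat.sub_self,
    sum_twist_monicFinset_zero, mul_one, sum_twist_monicFinset_one] at h1
  have h2 := hω 1 le_rfl
  rw [h1, h2, norm_neg]
  calc ‖∑ i, ω i ^ 1‖ ≤ ∑ i, ‖ω i ^ 1‖ := norm_sum_le _ _
    _ ≤ ∑ _i : Fin R.card, Real.sqrt p := Finset.sum_le_sum fun i _ => by simpa using hnorm i
    _ = R.card * Real.sqrt p := by simp

end

lemma one_le_log_of_three_le {p : ℕ} (hp : 3 ≤ p) : 1 ≤ Real.log p := by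
  rw [Real.le_log_iff_exp_le (by exact_mod_cast (by omega : 0 < p))]
  have h1 : (3 : ℝ) ≤ p := by exact_mod_cast hp
  linarith [Real.exp_one_lt_d9]

section Completion

variable {p : ℕ} [Fact p.Prime]

lemma sum_range_natCast_zmod {β : Type*} [AddCommMonoid β] (F : ZMod p → β) :
    ∑ k ∈ Finset.range p, F (k : ZMod p) = ∑ a, F a := by
  refine Finset.sum_nbij' (fun k => (k : ZMod p)) (fun a => a.val) ?_ ?_ ?_ ?_ ?_
  · simp
  · intro a _
    exact Finset.mem_range.2 a.val_lt
  · intro k hk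
    exact ZMod.val_cast_of_lt (Finset.mem_range.1 hk)
  · intro a _
    exact ZMod.natCast_zmod_val a
  · simp

lemma inv_sin_pi_mul_div_le {k q : ℕ} (hk : 0 < k) (hkq : k < q) :
    0 < Real.sin (Real.pi * k / q) ∧
      (Real.sin (Real.pi * k / q))⁻¹ ≤ q / 2 * ((k : ℝ)⁻¹ + ((q - k : ℕ) : ℝ)⁻¹) := by
  have main : ∀ j : ℕ, 0 < j → 2 * j ≤ q → 0 < Real.sin (Real.pi * j / q) ∧
      (Real.sin (Real.pi * j / q))⁻¹ ≤ q / 2 * (j : ℝ)⁻¹ := by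
    intro j hj hjq
    have hj0 : (0 : ℝ) < j := by exact_mod_cast hj
    have hjq' : (2 * j : ℝ) ≤ q := by exact_mod_cast hjq
    have hq0 : (0 : ℝ) < q := by linarith
    have h1 : 2 / Real.pi * (Real.pi * j / q) ≤ Real.sin (Real.pi * j / q) := by
      refine Real.mul_le_sin (by positivity) ?_
      rw [div_le_div_iff₀ hq0 two_pos]
      nlinarith [Real.pi_pos]
    have h2 : 2 / Real.pi * (Real.pi * j / q) = 2 * j / q := by
      field_simp
    rw [h2] at h1
    have h3 : (0 : ℝ) < 2 * j / q := by positivity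
    refine ⟨h3.trans_le h1, (inv_anti₀ h3 h1).trans (le_of_eq ?_)⟩
    field_simp
  have hq : (0 : ℝ) < q := by exact_mod_cast hk.trans hkq
  rcases le_or_gt (2 * k) q with h | h
  · obtain ⟨h1, h2⟩ := main k hk h
    refine ⟨h1, h2.trans (mul_le_mul_of_nonneg_left ?_ (by positivity))⟩
    simp
  · obtain ⟨h1, h2⟩ := main (q - k) (by omega) (by omega)
    have h3 : Real.sin (Real.pi * (q - k : ℕ) / q) = Real.sin (Real.pi * k / q) := by
      rw [← Real.sin_pi_sub, Nat.cast_sub hkq.le]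
      congr 1
      field_simp
      ring
    rw [h3] at h1 h2
    refine ⟨h1, h2.trans (mul_le_mul_of_nonneg_left ?_ (by positivity))⟩
    simp

lemma norm_sum_range_stdAddChar_le {k : ℕ} (hk : 0 < k) (hkp : k < p) (M : ℕ) :
    ‖∑ m ∈ Finset.range M, ZMod.stdAddChar ((m : ZMod p) * (k : ZMod p))‖
      ≤ p / 2 * ((k : ℝ)⁻¹ + ((p - k : ℕ) : ℝ)⁻¹) := by
  obtain ⟨h1, h2⟩ := inv_sin_pi_mul_div_le hk hkp
  set z : ℂ := ZMod.stdAddChar (k : ZMod p) with hz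
  have hz1 : ‖z‖ = 1 := AddChar.norm_apply _ _
  have hsub : ‖z - 1‖ = 2 * Real.sin (Real.pi * k / p) := by
    have h3 : z = Complex.exp (Complex.I * ((2 * (Real.pi * k / p) : ℝ) : ℂ)) := by
      have h4 := ZMod.stdAddChar_coe (N := p) (k : ℤ)
      rw [Int.cast_natCast] at h4
      rw [hz, h4]
      congr 1
      push_cast
      ring
    rw [h3, Complex.norm_exp_I_mul_ofReal_sub_one, mul_div_cancel_left₀ _ two_ne_zero,
      Real.norm_of_nonneg (by positivity)]
  have hne : z ≠ 1 := by
    intro h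
    rw [h, sub_self, norm_zero] at hsub
    linarith
  have hpow (m : ℕ) : ZMod.stdAddChar ((m : ZMod p) * (k : ZMod p)) = z ^ m := by
    rw [← nsmul_eq_mul, AddChar.map_nsmul_eq_pow]
  simp only [hpow]
  rw [geom_sum_eq hne, norm_div, hsub]
  refine le_trans ?_ h2
  rw [div_le_iff₀ (by positivity)]
  have h5 : ‖z ^ M - 1‖ ≤ 2 := by
    refine (norm_sub_le _ _).trans ?_
    rw [norm_pow, hz1, one_pow, norm_one]
    norm_num
  refine h5.trans (le_of_eq ?_)
  field_simp

lemma sum_inv_add_inv_sub_le (q : ℕ) :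
    ∑ i ∈ Finset.range q, (((i + 1 : ℕ) : ℝ)⁻¹ + ((q - i : ℕ) : ℝ)⁻¹)
      ≤ 2 * (1 + Real.log q) := by
  have h1 : ∑ i ∈ Finset.range q, ((i + 1 : ℕ) : ℝ)⁻¹ ≤ 1 + Real.log q := by
    have := harmonic_le_one_add_log q
    rw [harmonic] at this
    push_cast at this ⊢
    exact this
  have h2 : ∑ i ∈ Finset.range q, ((q - i : ℕ) : ℝ)⁻¹
      = ∑ i ∈ Finset.range q, ((i + 1 : ℕ) : ℝ)⁻¹ := by
    rw [← Finset.sum_range_reflect]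
    refine Finset.sum_congr rfl fun i hi => ?_
    rw [Finset.mem_range] at hi
    congr 2
    omega
  rw [Finset.sum_add_distrib, h2]
  linarith

lemma sum_norm_sum_range_stdAddChar_le (hp3 : 3 ≤ p) {M : ℕ} (hM : M ≤ p) :
    ∑ a : ZMod p, ‖∑ m ∈ Finset.range M, ZMod.stdAddChar ((m : ZMod p) * a)‖
      ≤ 3 * p * Real.log p := by
  have hlog := one_le_log_of_three_le hp3
  have hp0 : (0 : ℝ) < p := by exact_mod_cast (by omega : 0 < p)
  rw [← sum_range_natCast_zmod]
  obtain ⟨q, rfl⟩ : ∃ q, p = q + 1 := ⟨p - 1, by omega⟩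
  rw [Finset.sum_range_succ']
  have h0 : ‖∑ m ∈ Finset.range M, ZMod.stdAddChar ((m : ZMod (q + 1)) * ((0 : ℕ) : ZMod (q + 1)))‖
      ≤ (q + 1 : ℕ) := by
    simpa using (by exact_mod_cast hM : (M : ℝ) ≤ (q + 1 : ℕ))
  have h1 : ∑ i ∈ Finset.range q, ‖∑ m ∈ Finset.range M,
      ZMod.stdAddChar ((m : ZMod (q + 1)) * ((i + 1 : ℕ) : ZMod (q + 1)))‖
      ≤ (q + 1 : ℕ) / 2 * (2 * (1 + Real.log q)) := by
    refine le_trans ?_ (mul_le_mul_of_nonneg_left (sum_inv_add_inv_sub_le q) (by positivity))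
    rw [Finset.mul_sum]
    refine Finset.sum_le_sum fun i hi => ?_
    rw [Finset.mem_range] at hi
    have := norm_sum_range_stdAddChar_le (p := q + 1) (k := i + 1) (by omega) (by omega) M
    rwa [show q + 1 - (i + 1) = q - i by omega] at this
  have h2 : Real.log q ≤ Real.log (q + 1 : ℕ) :=
    Real.log_le_log (by exact_mod_cast (by omega : 0 < q)) (by push_cast; linarith)
  nlinarith

/-- Completion of an incomplete sum over an initial segment. -/
lemma norm_sum_range_le_mul_log (hp3 : 3 ≤ p) {f : ZMod p → ℂ} {B : ℝ}
    (hB : ∀ ψ : AddChar (ZMod p) ℂ, ‖∑ x, f x * ψ x‖ ≤ B) {M : ℕ} (hM : M ≤ p) :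
    ‖∑ m ∈ Finset.range M, f (m : ZMod p)‖ ≤ 3 * B * Real.log p := by
  have hp0 : (0 : ℝ) < p := by exact_mod_cast (by omega : 0 < p)
  have hinv (y : ZMod p) : ∑ a : ZMod p, (∑ x, f x * ZMod.stdAddChar.mulShift (-a) x) *
      ZMod.stdAddChar (y * a) = p * f y := by
    calc _ = ∑ x, f x * ∑ a : ZMod p, ZMod.stdAddChar (a * (y - x)) := by
          simp only [Finset.sum_mul, Finset.mul_sum]
          rw [Finset.sum_comm]
          refine Finset.sum_congr rfl fun x _ => Finset.sum_congr rfl fun a _ => ?_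
          rw [AddChar.mulShift_apply, mul_assoc, ← AddChar.map_add_eq_mul]
          congr 2
          ring
      _ = p * f y := by
          simp only [AddChar.sum_mulShift _ (ZMod.isPrimitive_stdAddChar p), sub_eq_zero]
          rw [Finset.sum_eq_single y]
          · simp [ZMod.card, mul_comm]
          · intro x _ hx
            simp [hx.symm]
          · simp
  have hB0 : 0 ≤ B := (norm_nonneg _).trans (hB 1)
  have h1 : (p : ℝ) * ‖∑ m ∈ Finset.range M, f (m : ZMod p)‖ ≤ B * (3 * p * Real.log p) := by
    calc (p : ℝ) * ‖∑ m ∈ Finset.range M, f (m : ZMod p)‖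
        = ‖∑ m ∈ Finset.range M, (p : ℂ) * f (m : ZMod p)‖ := by
          rw [← Finset.mul_sum, norm_mul, Complex.norm_natCast]
      _ = ‖∑ a : ZMod p, (∑ x, f x * ZMod.stdAddChar.mulShift (-a) x) *
            ∑ m ∈ Finset.range M, ZMod.stdAddChar ((m : ZMod p) * a)‖ := by
          simp only [← hinv, Finset.mul_sum]
          rw [Finset.sum_comm]
      _ ≤ ∑ a : ZMod p, B * ‖∑ m ∈ Finset.range M, ZMod.stdAddChar ((m : ZMod p) * a)‖ := by
          refine (norm_sum_le _ _).trans (Finset.sum_le_sum fun a _ => ?_)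
          rw [norm_mul]
          exact mul_le_mul_of_nonneg_right (hB _) (norm_nonneg _)
      _ ≤ B * (3 * p * Real.log p) := by
          rw [← Finset.mul_sum]
          exact mul_le_mul_of_nonneg_left (sum_norm_sum_range_stdAddChar_le hp3 hM) hB0
  refine le_of_mul_le_mul_left (h1.trans (le_of_eq ?_)) hp0
  ring

end Completion

section FactorialSums

variable {p : ℕ} [Fact p.Prime]

/-- The quadratic character modulo `p`, as a real-valued function of a natural number. -/
noncomputable def realQuadraticChar (p : ℕ) [Fact p.Prime] (m : ℕ) : ℝ :=
  (quadraticChar (ZMod p) (m : ZMod p) : ℝ)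

lemma realQuadraticChar_mul (a b : ℕ) :
    realQuadraticChar p (a * b) = realQuadraticChar p a * realQuadraticChar p b := by
  rw [realQuadraticChar, Nat.cast_mul, map_mul, Int.cast_mul]
  rfl

lemma abs_quadraticChar_eq_one {x : ZMod p} (hx : x ≠ 0) :
    |(quadraticChar (ZMod p) x : ℝ)| = 1 := by
  rcases quadraticChar_dichotomy hx with h | h <;> simp [h]

lemma abs_realQuadraticChar_le_one (m : ℕ) : |realQuadraticChar p m| ≤ 1 := by
  by_cases h : (m : ZMod p) = 0
  · simp [realQuadraticChar, h]
  · exact (abs_quadraticChar_eq_one h).le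

lemma abs_sum_quadraticChar_prod_sub_le (hp3 : 3 ≤ p) {R : Finset (ZMod p)} (hR : R.Nonempty)
    {M : ℕ} (hM : M ≤ p) :
    |∑ m ∈ Finset.range M, (quadraticChar (ZMod p) (∏ c ∈ R, (c - (m : ZMod p))) : ℝ)|
      ≤ 3 * R.card * (Real.sqrt p * Real.log p) := by
  have h := norm_sum_range_le_mul_log hp3
    (norm_sum_quadraticChar_mul_addChar_zmod_le (by omega) hR) hM
  have h2 : ∑ m ∈ Finset.range M,
      ((quadraticChar (ZMod p) (∏ c ∈ R, (c - (m : ZMod p))) : ℤ) : ℂ)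
      = ((∑ m ∈ Finset.range M,
          ((quadraticChar (ZMod p) (∏ c ∈ R, (c - (m : ZMod p))) : ℤ) : ℝ) : ℝ) : ℂ) := by
    push_cast
    rfl
  rw [h2, Complex.norm_real, Real.norm_eq_abs] at h
  linarith

lemma abs_sum_realQuadraticChar_le (hp3 : 3 ≤ p) {M : ℕ} (hM : M ≤ p) :
    |∑ m ∈ Finset.range M, realQuadraticChar p m| ≤ 3 * (Real.sqrt p * Real.log p) := by
  have h := abs_sum_quadraticChar_prod_sub_le hp3 (Finset.singleton_nonempty (0 : ZMod p)) hM
  simp only [Finset.prod_singleton, zero_sub, Finset.card_singleton, Nat.cast_one, mul_one] at h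
  refine le_trans (le_of_eq ?_) h
  have h1 (m : ℕ) : (quadraticChar (ZMod p) (-(m : ZMod p)) : ℝ)
      = (quadraticChar (ZMod p) (-1) : ℝ) * realQuadraticChar p m := by
    rw [neg_eq_neg_one_mul, map_mul, realQuadraticChar]
    push_cast
    rfl
  simp only [h1, ← Finset.mul_sum, abs_mul]
  rw [abs_quadraticChar_eq_one (by simp), one_mul]

lemma abs_sum_realQuadraticChar_prod_le (hp3 : 3 ≤ p) {M k l : ℕ} (hM : M ≤ p) (hkl : k < l)
    (hl : l ≤ p) :
    |∑ m ∈ Finset.range M, realQuadraticChar p (∏ i ∈ Finset.Ico k l, (m + i + 1))|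
      ≤ 3 * l * (Real.sqrt p * Real.log p) := by
  have hlog := one_le_log_of_three_le hp3
  set R : Finset (ZMod p) := (Finset.Ico k l).image fun i => -((i + 1 : ℕ) : ZMod p) with hR
  have hinj : Set.InjOn (fun i : ℕ => -((i + 1 : ℕ) : ZMod p)) (Finset.Ico k l) := by
    intro i hi j hj hij
    simp only [Finset.coe_Ico, Set.mem_Ico] at hi hj
    have h1 : (i : ZMod p) = (j : ZMod p) := by simpa using hij
    rw [ZMod.natCast_eq_natCast_iff', Nat.mod_eq_of_lt (by omega), Nat.mod_eq_of_lt (by omega)] at h1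
    exact h1
  have hcard : R.card = l - k := by rw [hR, Finset.card_image_of_injOn hinj, Nat.card_Ico]
  have hne : R.Nonempty := Finset.card_pos.1 (by omega)
  have h := abs_sum_quadraticChar_prod_sub_le hp3 hne hM
  have h1 (m : ℕ) : (quadraticChar (ZMod p) (∏ c ∈ R, (c - (m : ZMod p))) : ℝ)
      = (quadraticChar (ZMod p) ((-1) ^ (l - k)) : ℝ)
        * realQuadraticChar p (∏ i ∈ Finset.Ico k l, (m + i + 1)) := by
    rw [realQuadraticChar, ← Int.cast_mul, ← map_mul, hR, Finset.prod_image hinj]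
    congr 2
    rw [← Nat.card_Ico k l, ← Finset.prod_const, Nat.cast_prod, ← Finset.prod_mul_distrib]
    refine Finset.prod_congr rfl fun i _ => ?_
    push_cast
    ring
  simp only [h1, ← Finset.mul_sum, abs_mul] at h
  rw [abs_quadraticChar_eq_one (by simp), one_mul, hcard] at h
  refine h.trans ?_
  have h2 : ((l - k : ℕ) : ℝ) ≤ l := by exact_mod_cast Nat.sub_le l k
  gcongr

lemma card_filter_dvd_prod_le {M : ℕ} (hM : M ≤ p) (k : ℕ) :
    ((Finset.range M).filter fun m =>
      ((∏ i ∈ Finset.range k, (m + i + 1) : ℕ) : ZMod p) = 0).card ≤ k := by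
  have h : ((Finset.range M).filter fun m =>
      ((∏ i ∈ Finset.range k, (m + i + 1) : ℕ) : ZMod p) = 0) ⊆ Finset.Ico (p - k) p := by
    intro m hm
    rw [Finset.mem_filter, Finset.mem_range, ZMod.natCast_eq_zero_iff,
      (Fact.out : p.Prime).prime.dvd_finsetProd_iff] at hm
    obtain ⟨hm, i, hi, hd⟩ := hm
    have := Nat.le_of_dvd (by omega) hd
    rw [Finset.mem_range] at hi
    rw [Finset.mem_Ico]
    omega
  refine (Finset.card_le_card h).trans ?_
  rw [Nat.card_Ico]
  omega

lemma abs_sum_realQuadraticChar_prod_mul_prod_le (hp3 : 3 ≤ p) {M k l : ℕ} (hM : M ≤ p)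
    (hkl : k < l) (hl : l ≤ p) :
    |∑ m ∈ Finset.range M, realQuadraticChar p (∏ i ∈ Finset.range k, (m + i + 1)) *
        realQuadraticChar p (∏ i ∈ Finset.range l, (m + i + 1))|
      ≤ 3 * l * (Real.sqrt p * Real.log p) + l := by
  have h1 := abs_sum_realQuadraticChar_prod_le hp3 hM hkl hl
  set f : ℕ → ℝ := fun m => realQuadraticChar p (∏ i ∈ Finset.Ico k l, (m + i + 1))
  set z : ℕ → ℝ := fun m =>
    if ((∏ i ∈ Finset.range k, (m + i + 1) : ℕ) : ZMod p) = 0 then f m else 0 with hz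
  have h2 (m : ℕ) : realQuadraticChar p (∏ i ∈ Finset.range k, (m + i + 1)) *
      realQuadraticChar p (∏ i ∈ Finset.range l, (m + i + 1)) = f m - z m := by
    rw [← Finset.prod_range_mul_prod_Ico _ hkl.le, realQuadraticChar_mul, ← mul_assoc, ← sq]
    simp only [hz]
    split_ifs with h
    · simp [realQuadraticChar, h]
    · rw [realQuadraticChar, ← Int.cast_pow, quadraticChar_sq_one h]
      simp [f]
  have h3 : |∑ m ∈ Finset.range M, z m| ≤ k := by
    rw [hz, ← Finset.sum_filter]
    refine (Finset.abs_sum_le_sum_abs _ _).trans ?_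
    refine (Finset.sum_le_card_nsmul _ _ 1 fun m _ => abs_realQuadraticChar_le_one _).trans ?_
    rw [nsmul_eq_mul, mul_one]
    exact_mod_cast card_filter_dvd_prod_le hM k
  have h4 : (k : ℝ) ≤ l := by exact_mod_cast hkl.le
  simp only [h2, Finset.sum_sub_distrib]
  refine (abs_sub _ _).trans ?_
  linarith

lemma sum_abs_sum_realQuadraticChar_sq_le (hp3 : 3 ≤ p) {M K : ℕ} (hM : M ≤ p) (hK : K ≤ p) :
    (∑ m ∈ Finset.range M, |∑ k ∈ Finset.range K,
        realQuadraticChar p (∏ i ∈ Finset.range k, (m + i + 1))|) ^ 2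
      ≤ M * (K * M + K ^ 2 * (3 * K * (Real.sqrt p * Real.log p) + K)) := by
  have hlog := one_le_log_of_three_le hp3
  set c : ℕ → ℕ → ℝ := fun k m => realQuadraticChar p (∏ i ∈ Finset.range k, (m + i + 1))
  set E : ℝ := 3 * K * (Real.sqrt p * Real.log p) + K with hE
  have hE0 : 0 ≤ E := by positivity
  have hlt : ∀ k l, k < l → l < K → |∑ m ∈ Finset.range M, c k m * c l m| ≤ E := by
    intro k l hkl hl
    have h1 : (l : ℝ) ≤ K := by exact_mod_cast hl.le
    refine (abs_sum_realQuadraticChar_prod_mul_prod_le hp3 hM hkl (by omega)).trans ?_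
    rw [hE]
    gcongr
  have hpair : ∀ k ∈ Finset.range K, ∀ l ∈ Finset.range K,
      ∑ m ∈ Finset.range M, c k m * c l m ≤ E + if k = l then (M : ℝ) else 0 := by
    intro k hk l hl
    rw [Finset.mem_range] at hk hl
    rcases lt_trichotomy k l with h | h | h
    · rw [if_neg h.ne, add_zero]
      exact (le_abs_self _).trans (hlt k l h hl)
    · subst h
      rw [if_pos rfl]
      have : ∑ m ∈ Finset.range M, c k m * c k m ≤ ∑ _m ∈ Finset.range M, (1 : ℝ) := by
        refine Finset.sum_le_sum fun m _ => ?_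
        rw [← sq, ← sq_abs]
        exact pow_le_one₀ (abs_nonneg _) (abs_realQuadraticChar_le_one _)
      simp only [Finset.sum_const, Finset.card_range, nsmul_eq_mul, mul_one] at this
      linarith
    · rw [if_neg h.ne', add_zero]
      simp only [mul_comm (c k _)]
      exact (le_abs_self _).trans (hlt l k h hk)
  calc (∑ m ∈ Finset.range M, |∑ k ∈ Finset.range K, c k m|) ^ 2
      ≤ M * ∑ m ∈ Finset.range M, |∑ k ∈ Finset.range K, c k m| ^ 2 := by
        simpa using sq_sum_le_card_mul_sum_sq (s := Finset.range M)
          (f := fun m => |∑ k ∈ Finset.range K, c k m|)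
    _ = M * ∑ k ∈ Finset.range K, ∑ l ∈ Finset.range K, ∑ m ∈ Finset.range M, c k m * c l m := by
        congr 1
        simp only [sq_abs]
        simp only [sq, Finset.sum_mul_sum]
        rw [Finset.sum_comm]
        exact Finset.sum_congr rfl fun k _ => Finset.sum_comm
    _ ≤ M * ∑ k ∈ Finset.range K, ∑ l ∈ Finset.range K, (E + if k = l then (M : ℝ) else 0) := by
        refine mul_le_mul_of_nonneg_left ?_ (Nat.cast_nonneg _)
        exact Finset.sum_le_sum fun k hk => Finset.sum_le_sum fun l hl => hpair k hk l hl
    _ = M * (K * M + K ^ 2 * E) := by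
        congr 1
        simp only [Finset.sum_add_distrib, Finset.sum_ite_eq]
        rw [Finset.sum_congr rfl fun k hk => if_pos hk]
        simp
        ring

lemma abs_sum_sub_sum_shift_le {a : ℕ → ℝ} (ha : ∀ m, |a m| ≤ 1) (M k : ℕ) :
    |∑ m ∈ Finset.range M, a m - ∑ m ∈ Finset.range M, a (m + k)| ≤ 2 * k := by
  have h1 : ∑ m ∈ Finset.range M, a m + ∑ m ∈ Finset.range k, a (M + m)
      = ∑ m ∈ Finset.range k, a m + ∑ m ∈ Finset.range M, a (m + k) := by
    rw [← Finset.sum_range_add, add_comm M k, Finset.sum_range_add]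
    simp only [add_comm k]
  have h2 (b : ℕ → ℝ) (hb : ∀ m, |b m| ≤ 1) : |∑ m ∈ Finset.range k, b m| ≤ k := by
    refine (Finset.abs_sum_le_sum_abs _ _).trans ?_
    refine (Finset.sum_le_card_nsmul _ _ 1 fun m _ => hb m).trans ?_
    simp
  have h3 := h2 a ha
  have h4 := h2 (fun m => a (M + m)) fun m => ha _
  rw [abs_le] at h3 h4 ⊢
  constructor <;> linarith [h3.1, h3.2, h4.1, h4.2]

open Nat in
lemma mul_abs_sum_realQuadraticChar_factorial_le (M K : ℕ) :
    K * |∑ m ∈ Finset.range M, realQuadraticChar p m !|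
      ≤ ∑ m ∈ Finset.range M, |∑ k ∈ Finset.range K,
        realQuadraticChar p (∏ i ∈ Finset.range k, (m + i + 1))| + (K : ℝ) ^ 2 := by
  set S := ∑ m ∈ Finset.range M, realQuadraticChar p m ! with hS
  have hfac (m k : ℕ) : realQuadraticChar p (m + k)! = realQuadraticChar p m ! *
      realQuadraticChar p (∏ i ∈ Finset.range k, (m + i + 1)) := by
    rw [← realQuadraticChar_mul]
    congr 1
    induction k with
    | zero => simp
    | succ k ih =>
      rw [Finset.prod_range_succ, ← mul_assoc, ← ih, ← add_assoc, Nat.factorial_succ, mul_comm]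
  have h1 : |∑ k ∈ Finset.range K, (S - ∑ m ∈ Finset.range M, realQuadraticChar p (m + k)!)|
      ≤ (K : ℝ) ^ 2 := by
    refine (Finset.abs_sum_le_sum_abs _ _).trans ?_
    have h2 : ∑ k ∈ Finset.range K, (2 * k : ℝ) ≤ (K : ℝ) ^ 2 := by
      have h3 := Finset.sum_range_id_mul_two K
      have h4 : (∑ k ∈ Finset.range K, (k : ℝ)) * 2 = ((K * (K - 1) : ℕ) : ℝ) := by
        rw [← h3]
        push_cast
        rfl
      have h5 : ((K * (K - 1) : ℕ) : ℝ) ≤ (K : ℝ) ^ 2 := by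
        rw [sq]
        exact_mod_cast Nat.mul_le_mul_left K (Nat.sub_le K 1)
      rw [← Finset.mul_sum]
      linarith
    refine le_trans (Finset.sum_le_sum fun k _ => ?_) h2
    exact abs_sum_sub_sum_shift_le (a := fun m => realQuadraticChar p m !)
      (fun m => abs_realQuadraticChar_le_one _) M k
  have h6 : |∑ k ∈ Finset.range K, ∑ m ∈ Finset.range M, realQuadraticChar p (m + k)!|
      ≤ ∑ m ∈ Finset.range M, |∑ k ∈ Finset.range K,
        realQuadraticChar p (∏ i ∈ Finset.range k, (m + i + 1))| := by
    rw [Finset.sum_comm]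
    refine (Finset.abs_sum_le_sum_abs _ _).trans (Finset.sum_le_sum fun m _ => ?_)
    simp only [hfac, ← Finset.mul_sum]
    rw [abs_mul]
    exact mul_le_of_le_one_left (abs_nonneg _) (abs_realQuadraticChar_le_one _)
  rw [Finset.sum_sub_distrib, Finset.sum_const, Finset.card_range, nsmul_eq_mul] at h1
  have h7 : (K : ℝ) * |S| = |(K : ℝ) * S| := by rw [abs_mul, Nat.abs_cast]
  rw [h7]
  have h8 := abs_sub_abs_le_abs_sub ((K : ℝ) * S)
    (∑ k ∈ Finset.range K, ∑ m ∈ Finset.range M, realQuadraticChar p (m + k)!)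
  linarith

open Nat in
/-- The bound for sums of the quadratic character over factorials. -/
theorem abs_sum_realQuadraticChar_factorial_pow_four_le (hp3 : 3 ≤ p) {M : ℕ} (hM : M ≤ p)
    (hQM : Real.sqrt p * Real.log p ≤ M) :
    |∑ m ∈ Finset.range M, realQuadraticChar p m !| ^ 4
      ≤ 676 * (M : ℝ) ^ 3 * (Real.sqrt p * Real.log p) := by
  have hlog := one_le_log_of_three_le hp3
  have hsqrt : 1 ≤ Real.sqrt p := by
    rw [Real.one_le_sqrt]
    exact_mod_cast (by omega : 1 ≤ p)
  set Q : ℝ := Real.sqrt p * Real.log p with hQ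
  have hQ1 : 1 ≤ Q := one_le_mul_of_one_le_of_one_le hsqrt hlog
  set x : ℝ := Real.sqrt (M / Q) with hx
  have hx1 : 1 ≤ x := by
    rw [hx, Real.one_le_sqrt, one_le_div (by linarith)]
    exact hQM
  have hMx : (M : ℝ) = Q * x ^ 2 := by
    rw [hx, Real.sq_sqrt (by positivity)]
    field_simp
  set K : ℕ := ⌈x⌉₊ with hK
  have hxK : x ≤ K := Nat.le_ceil x
  have hKx : (K : ℝ) ≤ 2 * x := by
    have := Nat.ceil_lt_add_one (by linarith : 0 ≤ x)
    linarith
  have hKM : K ≤ M := by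
    rw [hK, Nat.ceil_le, hMx]
    nlinarith
  have h1 := sum_abs_sum_realQuadraticChar_sq_le hp3 hM (hKM.trans hM)
  have h2 := mul_abs_sum_realQuadraticChar_factorial_le (p := p) M K
  rw [← hQ] at h1
  set T := ∑ m ∈ Finset.range M, |∑ k ∈ Finset.range K,
        realQuadraticChar p (∏ i ∈ Finset.range k, (m + i + 1))| with hT
  have hT0 : 0 ≤ T := Finset.sum_nonneg fun _ _ => abs_nonneg _
  set S := |∑ m ∈ Finset.range M, realQuadraticChar p m !| with hS
  have hS0 : 0 ≤ S := abs_nonneg _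
  generalize (K : ℝ) = y at *
  generalize (M : ℝ) = N at *
  have hy0 : 0 < y := by linarith
  have h3 : y ^ 2 * S ^ 2 ≤ 2 * T ^ 2 + 2 * y ^ 4 := by
    have h4 : (y * S) ^ 2 ≤ (T + y ^ 2) ^ 2 := pow_le_pow_left₀ (by positivity) h2 2
    nlinarith [sq_nonneg (T - y ^ 2)]
  have h5 : y ^ 2 * S ^ 2 ≤ y ^ 2 * (26 * (Q ^ 2 * x ^ 3)) := by
    have e1 : y ^ 2 * y ≤ y ^ 2 * (2 * x) := by gcongr
    have e2 : y * N ^ 2 ≤ y ^ 2 * (Q ^ 2 * x ^ 3) := by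
      rw [hMx]
      have : x * (y * Q ^ 2 * x ^ 3) ≤ y * (y * Q ^ 2 * x ^ 3) := by gcongr
      linarith
    have e3 : N * (y ^ 2 * (3 * y * Q + y)) ≤ y ^ 2 * (8 * (Q ^ 2 * x ^ 3)) := by
      rw [hMx]
      calc Q * x ^ 2 * (y ^ 2 * (3 * y * Q + y)) ≤ Q * x ^ 2 * (y ^ 2 * (3 * y * Q + y * Q)) := by
            gcongr
            exact le_mul_of_one_le_right hy0.le hQ1
        _ = 4 * Q ^ 2 * x ^ 2 * y ^ 2 * y := by ring
        _ ≤ 4 * Q ^ 2 * x ^ 2 * y ^ 2 * (2 * x) := by gcongr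
        _ = _ := by ring
    have e4 : y ^ 4 ≤ y ^ 2 * (4 * (Q ^ 2 * x ^ 3)) := by
      calc y ^ 4 = y ^ 2 * (y * y) := by ring
        _ ≤ y ^ 2 * ((2 * x) * (2 * x)) := by gcongr
        _ = y ^ 2 * (4 * (1 ^ 2 * (x ^ 2 * 1))) := by ring
        _ ≤ y ^ 2 * (4 * (Q ^ 2 * (x ^ 2 * x))) := by gcongr
        _ = _ := by ring
    nlinarith
  have h6 : S ^ 2 ≤ 26 * (Q ^ 2 * x ^ 3) := le_of_mul_le_mul_left h5 (by positivity)
  calc S ^ 4 = (S ^ 2) ^ 2 := by ring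
    _ ≤ (26 * (Q ^ 2 * x ^ 3)) ^ 2 := by gcongr
    _ = 676 * N ^ 3 * Q := by
      rw [hMx]
      ring

end FactorialSums

section Spacings

variable {p : ℕ} [Fact p.Prime]

lemma realQuadraticChar_eq_one {m : ℕ} (h0 : 0 < m) (hm : m < p) (h : IsSquare (m : ZMod p)) :
    realQuadraticChar p m = 1 := by
  have hne : (m : ZMod p) ≠ 0 := by
    rw [Ne, ZMod.natCast_eq_zero_iff]
    exact Nat.not_dvd_of_pos_of_lt h0 hm
  rw [realQuadraticChar, (quadraticChar_one_iff_isSquare hne).2 h, Int.cast_one]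

lemma realQuadraticChar_eq_neg_one {m : ℕ} (h : ¬ IsSquare (m : ZMod p)) :
    realQuadraticChar p m = -1 := by
  rw [realQuadraticChar, quadraticChar_neg_one_iff_not_isSquare.2 h]
  simp

lemma realQuadraticChar_between_eq_one {n : ℕ → ℕ}
    (hlt : ∀ j k : ℕ, j < k → k ≤ (p - 1) / 2 → n j < n k)
    (hmem : ∀ j : ℕ, 1 ≤ j → j ≤ (p - 1) / 2 →
      n j ∈ Finset.Icc 1 (p - 1) ∧ ¬ IsSquare ((n j : ZMod p)))
    (hex : ∀ m ∈ Finset.Icc 1 (p - 1), ¬ IsSquare ((m : ZMod p)) →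
      ∃ j : ℕ, 1 ≤ j ∧ j ≤ (p - 1) / 2 ∧ n j = m)
    {j m : ℕ} (hj : j + 1 ≤ (p - 1) / 2) (h1 : n j < m)
    (h2 : m < n (j + 1)) : realQuadraticChar p m = 1 := by
  have h3 := Finset.mem_Icc.1 (hmem (j + 1) (by omega) hj).1
  refine realQuadraticChar_eq_one (by omega) (by omega) ?_
  by_contra hns
  obtain ⟨i, hi1, hi2, rfl⟩ := hex m (Finset.mem_Icc.2 ⟨by omega, by omega⟩) hns
  rcases lt_or_ge j i with h | h
  · rcases eq_or_lt_of_le (show j + 1 ≤ i from h) with h | h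
    · subst h
      exact lt_irrefl _ h2
    · exact absurd (hlt (j + 1) i h hi2) (by omega)
  · rcases eq_or_lt_of_le h with h | h
    · subst h
      exact lt_irrefl _ h1
    · exact absurd (hlt i j h (by omega)) (by omega)

open Nat in
lemma realQuadraticChar_factorial_eq {n : ℕ → ℕ} (h0 : n 0 = 0)
    (hlt : ∀ j k : ℕ, j < k → k ≤ (p - 1) / 2 → n j < n k)
    (hmem : ∀ j : ℕ, 1 ≤ j → j ≤ (p - 1) / 2 →
      n j ∈ Finset.Icc 1 (p - 1) ∧ ¬ IsSquare ((n j : ZMod p)))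
    (hex : ∀ m ∈ Finset.Icc 1 (p - 1), ¬ IsSquare ((m : ZMod p)) →
      ∃ j : ℕ, 1 ≤ j ∧ j ≤ (p - 1) / 2 ∧ n j = m)
    {J : ℕ} (hJ : J ≤ (p - 1) / 2) :
    realQuadraticChar p (n J)! = (-1) ^ J ∧
      ∑ m ∈ Finset.range (n J), realQuadraticChar p m !
        = -∑ j ∈ Finset.Icc 1 J, (-1 : ℝ) ^ j * ((n j : ℝ) - (n (j - 1) : ℝ)) ∧
      ∑ m ∈ Finset.range (n J), (1 - realQuadraticChar p (m + 1)) = 2 * J := by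
  induction J with
  | zero => simp [h0, realQuadraticChar]
  | succ J ih =>
    obtain ⟨ih1, ih2, ih3⟩ := ih (by omega)
    have hJlt := hlt J (J + 1) (by omega) hJ
    have hone := fun {m : ℕ} => realQuadraticChar_between_eq_one (m := m) hlt hmem hex hJ
    have hneg := realQuadraticChar_eq_neg_one (hmem (J + 1) (by omega) hJ).2
    have hconst : ∀ i, n J + i < n (J + 1) → realQuadraticChar p (n J + i)! = (-1) ^ J := by
      intro i
      induction i with
      | zero => exact fun _ => ih1
      | succ i ihi =>
        intro hi
        rw [← add_assoc, Nat.factorial_succ, realQuadraticChar_mul, ihi (by omega),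
          hone (by omega) (by omega), one_mul]
    obtain ⟨e, he⟩ : ∃ e, n (J + 1) = n J + e + 1 := ⟨n (J + 1) - n J - 1, by omega⟩
    refine ⟨?_, ?_, ?_⟩
    · rw [he] at hneg ⊢
      rw [Nat.factorial_succ, realQuadraticChar_mul, hneg, hconst e (by omega), pow_succ]
      ring
    · rw [Finset.sum_Icc_succ_top (by omega), he, add_assoc, Finset.sum_range_add, ih2,
        Finset.sum_congr rfl fun i hi => hconst i (by rw [Finset.mem_range] at hi; omega)]
      simp
      ring
    · rw [he, add_assoc, Finset.sum_range_add, ih3, Finset.sum_range_succ, ← add_assoc, ← he, hneg,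
        Finset.sum_eq_zero]
      · push_cast
        ring
      · intro i hi
        rw [Finset.mem_range] at hi
        rw [hone (by omega) (by omega), sub_self]

lemma natCast_nonresidue_le {n : ℕ → ℕ} (h0 : n 0 = 0)
    (hlt : ∀ j k : ℕ, j < k → k ≤ (p - 1) / 2 → n j < n k)
    (hmem : ∀ j : ℕ, 1 ≤ j → j ≤ (p - 1) / 2 →
      n j ∈ Finset.Icc 1 (p - 1) ∧ ¬ IsSquare ((n j : ZMod p)))
    (hex : ∀ m ∈ Finset.Icc 1 (p - 1), ¬ IsSquare ((m : ZMod p)) →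
      ∃ j : ℕ, 1 ≤ j ∧ j ≤ (p - 1) / 2 ∧ n j = m)
    (hp3 : 3 ≤ p) {J : ℕ} (hJ : J ≤ (p - 1) / 2)
    (hn : n J < p) : (n J : ℝ) ≤ 2 * J + 3 * (Real.sqrt p * Real.log p) := by
  have h1 := (realQuadraticChar_factorial_eq h0 hlt hmem hex hJ).2.2
  have h2 := abs_sum_realQuadraticChar_le hp3 (M := n J + 1) hn
  rw [Finset.sum_range_succ'] at h2
  have h3 : realQuadraticChar p 0 = 0 := by simp [realQuadraticChar]
  rw [h3, add_zero] at h2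
  simp only [Finset.sum_sub_distrib, Finset.sum_const, Finset.card_range, nsmul_eq_mul,
    mul_one] at h1
  linarith [(abs_le.1 h2).2]

end Spacings

/-- Corollary on spacings between quadratic nonresidues: there is an absolute
constant `C > 0` such that for every odd prime `p`, if `n 0 = 0` and
`n 1 < n 2 < ⋯ < n ((p-1)/2)` enumerates the quadratic nonresidues modulo `p`
in `{1, …, p-1}` in increasing order, with spacings `d_j = n j - n (j-1)`,
then for every `J` with `√p · log p ≤ J ≤ (p-1)/2` one has
`|∑_{j=1}^J (-1)^j d_j| ≤ C J^{3/4} p^{1/8} (log p)^{1/4}`. -/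
theorem alternating_sum_nonresidue_spacings :
    ∃ C : ℝ, 0 < C ∧ ∀ p : ℕ, p.Prime → Odd p →
      ∀ n : ℕ → ℕ, n 0 = 0 →
      (∀ j k : ℕ, j < k → k ≤ (p - 1) / 2 → n j < n k) →
      (∀ j : ℕ, 1 ≤ j → j ≤ (p - 1) / 2 →
        n j ∈ Finset.Icc 1 (p - 1) ∧ ¬ IsSquare ((n j : ZMod p))) →
      (∀ m ∈ Finset.Icc 1 (p - 1), ¬ IsSquare ((m : ZMod p)) →
        ∃ j : ℕ, 1 ≤ j ∧ j ≤ (p - 1) / 2 ∧ n j = m) →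
      ∀ J : ℕ, Real.sqrt p * Real.log p ≤ (J : ℝ) → J ≤ (p - 1) / 2 →
        |∑ j ∈ Finset.Icc 1 J, (-1 : ℝ) ^ j * ((n j : ℝ) - (n (j - 1) : ℝ))| ≤
          C * (J : ℝ) ^ ((3 : ℝ) / 4) * (p : ℝ) ^ ((1 : ℝ) / 8) *
            (Real.log p) ^ ((1 : ℝ) / 4) := by
  refine ⟨18, by norm_num, ?_⟩
  intro p hp hodd n h0 hlt hmem hex J hQJ hJ
  have : Fact p.Prime := ⟨hp⟩
  have hp3 : 3 ≤ p := by
    have := hp.two_le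
    have : p ≠ 2 := by
      rintro rfl
      exact absurd hodd (by decide)
    omega
  have hlog := one_le_log_of_three_le hp3
  have hp0 : (0 : ℝ) < p := by exact_mod_cast hp.pos
  have hQ0 : 0 < Real.sqrt p * Real.log p := by positivity
  have hJ1 : 1 ≤ J := by
    by_contra! h
    rw [Nat.lt_one_iff.1 h, Nat.cast_zero] at hQJ
    linarith
  have hJn : J ≤ n J := by
    have : ∀ j, j ≤ (p - 1) / 2 → j ≤ n j := by
      intro j
      induction j with
      | zero => simp
      | succ j ih =>
        intro hj
        have := hlt j (j + 1) (by omega) hj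
        have := ih (by omega)
        omega
    exact this J hJ
  have hnp : n J < p := by
    have := Finset.mem_Icc.1 (hmem J hJ1 hJ).1
    omega
  have hJn' : (J : ℝ) ≤ n J := by exact_mod_cast hJn
  have h1 := abs_sum_realQuadraticChar_factorial_pow_four_le hp3 hnp.le (hQJ.trans hJn')
  rw [(realQuadraticChar_factorial_eq h0 hlt hmem hex hJ).2.1, abs_neg] at h1
  have h2 : (n J : ℝ) ≤ 5 * J := by
    linarith [natCast_nonresidue_le h0 hlt hmem hex hp3 hJ hnp]
  have hrhs : (18 * (J : ℝ) ^ ((3 : ℝ) / 4) * (p : ℝ) ^ ((1 : ℝ) / 8) *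
      (Real.log p) ^ ((1 : ℝ) / 4)) ^ 4 = 104976 * (J : ℝ) ^ 3 * (Real.sqrt p * Real.log p) := by
    have e1 : ((J : ℝ) ^ ((3 : ℝ) / 4)) ^ 4 = (J : ℝ) ^ 3 := by
      rw [← Real.rpow_natCast, ← Real.rpow_mul (by positivity), ← Real.rpow_natCast]
      norm_num
    have e2 : ((p : ℝ) ^ ((1 : ℝ) / 8)) ^ 4 = Real.sqrt p := by
      rw [← Real.rpow_natCast, ← Real.rpow_mul (by positivity), Real.sqrt_eq_rpow]
      norm_num
    have e3 : ((Real.log p) ^ ((1 : ℝ) / 4)) ^ 4 = Real.log p := by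
      rw [← Real.rpow_natCast, ← Real.rpow_mul (by positivity)]
      norm_num
    rw [mul_pow, mul_pow, mul_pow, e1, e2, e3]
    ring
  refine le_of_pow_le_pow_left₀ four_ne_zero (by positivity) ?_
  rw [hrhs]
  have h3 : (n J : ℝ) ^ 3 ≤ (5 * J) ^ 3 := by gcongr
  calc _ ≤ 676 * (n J : ℝ) ^ 3 * (Real.sqrt p * Real.log p) := h1
    _ ≤ 676 * (5 * J : ℝ) ^ 3 * (Real.sqrt p * Real.log p) := by gcongr
    _ = 84500 * (J : ℝ) ^ 3 * (Real.sqrt p * Real.log p) := by ring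
    _ ≤ 104976 * (J : ℝ) ^ 3 * (Real.sqrt p * Real.log p) := by
      gcongr
      norm_num
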